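/- arXiv:2311.07681 — 3 statements merged into one kernel-verified Lean document; each statement's English description precedes it below -/
import Mathlib

section
/- Theta-null transformation formula (slice form of the w = 0 case of Theorem 4.7): let d ≥ 1, let A be an invertible real d×d matrix, and define θ_L(z) = ∑_{m∈ℤ^d} exp(πi‖Am‖²·z) and θ_{L^♯}(z) = ∑_{k∈ℤ^d} exp(πi‖(Aᵀ)⁻¹k‖²·z) for Im z > 0. Then for every z ∈ ℂ with Im z > 0, θ_L(z) = (−iz)^{−d/2} · |det A|⁻¹ · θ_{L^♯}(−z⁻¹). -/
open Matrix

section PoissonSummation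

open MeasureTheory Set Topology UnitAddTorus

variable {ι : Type*}

/-- The half-open unit cubes with integral corners tile `ℝ^ι`. -/
theorem iUnion_pi_Ioc_intCast :
    ⋃ m : ι → ℤ, {x : ι → ℝ | ∀ i, x i ∈ Ioc (m i : ℝ) (m i + 1)} = univ := by
  refine eq_univ_of_forall fun x ↦ mem_iUnion.2 ⟨fun i ↦ ⌈x i⌉ - 1, fun i ↦ ?_⟩
  have h₁ := Int.ceil_lt_add_one (x i)
  have h₂ := Int.le_ceil (x i)
  push_cast
  constructor <;> linarith

theorem pairwise_disjoint_pi_Ioc_intCast :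
    Pairwise (Function.onFun Disjoint
      fun m : ι → ℤ ↦ {x : ι → ℝ | ∀ i, x i ∈ Ioc (m i : ℝ) (m i + 1)}) := by
  refine fun m n hmn ↦ Set.disjoint_left.2 fun x hm hn ↦ hmn (funext fun i ↦ ?_)
  have h₁ : (m i : ℝ) < n i + 1 := (hm i).1.trans_le (hn i).2
  have h₂ : (n i : ℝ) < m i + 1 := (hn i).1.trans_le (hm i).2
  norm_cast at h₁ h₂
  omega

theorem isOpenQuotientMap_pi_coe_unitAddCircle :
    IsOpenQuotientMap fun (x : ι → ℝ) i ↦ (x i : UnitAddCircle) :=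
  IsOpenQuotientMap.piMap fun _ ↦ QuotientAddGroup.isOpenQuotientMap_mk

variable [Fintype ι]

theorem measurableSet_pi_Ioc (a : ι → ℝ) :
    MeasurableSet {x : ι → ℝ | ∀ i, x i ∈ Ioc (a i) (a i + 1)} :=
  MeasurableSet.univ_pi' fun _ ↦ measurableSet_Ioc

theorem setIntegral_pi_Ioc_add {E : Type*} [NormedAddCommGroup E] [NormedSpace ℝ E]
    (f : (ι → ℝ) → E) (a : ι → ℝ) :
    ∫ x in {x : ι → ℝ | ∀ i, x i ∈ Ioc (0 : ℝ) (0 + 1)}, f (x + a) =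
      ∫ x in {x : ι → ℝ | ∀ i, x i ∈ Ioc (a i) (a i + 1)}, f x := by
  rw [← (measurePreserving_add_right volume a).setIntegral_preimage_emb
    (measurableEmbedding_addRight a) f]
  congr 2
  ext x
  refine forall_congr' fun i ↦ ?_
  simp only [Pi.add_apply, mem_Ioc]
  constructor <;> rintro ⟨h₁, h₂⟩ <;> constructor <;> linarith

/-- Unfolding: the integral over `ℝ^ι` is the integral of the periodization over a unit cube. -/
theorem integral_eq_setIntegral_tsum_add_intCast {f : (ι → ℝ) → ℂ} (hf : Integrable f) :
    ∫ x in {x : ι → ℝ | ∀ i, x i ∈ Ioc (0 : ℝ) (0 + 1)},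
      ∑' m : ι → ℤ, f (x + fun i ↦ (m i : ℝ)) = ∫ x, f x := by
  have key {E : Type} [NormedAddCommGroup E] [NormedSpace ℝ E] {g : (ι → ℝ) → E}
      (hg : Integrable g) :
      HasSum (fun m : ι → ℤ ↦ ∫ x in {x : ι → ℝ | ∀ i, x i ∈ Ioc (0 : ℝ) (0 + 1)},
        g (x + fun i ↦ (m i : ℝ))) (∫ x, g x) := by
    simp_rw [setIntegral_pi_Ioc_add]
    have := hasSum_integral_iUnion (fun m : ι → ℤ ↦ measurableSet_pi_Ioc fun i ↦ (m i : ℝ))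
      pairwise_disjoint_pi_Ioc_intCast hg.integrableOn
    rwa [iUnion_pi_Ioc_intCast, setIntegral_univ] at this
  rw [← (key hf).tsum_eq]
  exact (integral_tsum_of_summable_integral_norm
    (fun m ↦ (hf.comp_add_right _).integrableOn) (key hf.norm).summable).symm

theorem mFourier_coe (k : ι → ℤ) (x : ι → ℝ) :
    mFourier k (fun i ↦ (x i : UnitAddCircle)) =
      Complex.exp (2 * Real.pi * Complex.I * (∑ i, k i * x i : ℝ)) := by
  simp only [mFourier, ContinuousMap.coe_mk, fourier_coe_apply, ← Complex.exp_sum]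
  push_cast
  rw [Finset.mul_sum]
  congr! 2 with i
  ring

/-- **Poisson summation** on `ℝ^ι`, for functions whose periodization is dominated by a convergent
series on each ball. -/
theorem tsum_intCast_eq_tsum_integral {f : (ι → ℝ) → ℂ} (hc : Continuous f) (hi : Integrable f)
    (hb : ∀ R : ℝ, ∃ u : (ι → ℤ) → ℝ, Summable u ∧
      ∀ x ∈ Metric.ball 0 R, ∀ m : ι → ℤ, ‖f (x + fun i ↦ (m i : ℝ))‖ ≤ u m)
    (hs : Summable fun k : ι → ℤ ↦
      ∫ x : ι → ℝ, Complex.exp (-(2 * Real.pi * Complex.I * (∑ i, k i * x i : ℝ))) * f x) :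
    ∑' m : ι → ℤ, f (fun i ↦ (m i : ℝ)) = ∑' k : ι → ℤ,
      ∫ x : ι → ℝ, Complex.exp (-(2 * Real.pi * Complex.I * (∑ i, k i * x i : ℝ))) * f x := by
  let G : C(ι → ℝ, ℂ) := ⟨fun x ↦ ∑' m : ι → ℤ, f (x + fun i ↦ (m i : ℝ)), by
    refine continuous_iff_continuousAt.2 fun x ↦ ?_
    obtain ⟨u, hu, hfu⟩ := hb (‖x‖ + 1)
    refine ContinuousOn.continuousAt (s := Metric.ball 0 (‖x‖ + 1))
      (continuousOn_tsum (fun m ↦ by fun_prop) hu fun m x hx ↦ hfu x hx m)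
      (Metric.isOpen_ball.mem_nhds (by simp))⟩
  let P : C(ι → ℝ, UnitAddTorus ι) :=
    ⟨fun x i ↦ (x i : UnitAddCircle), isOpenQuotientMap_pi_coe_unitAddCircle.continuous⟩
  have hP : IsQuotientMap P := isOpenQuotientMap_pi_coe_unitAddCircle.isQuotientMap
  have hG : Function.FactorsThrough G P := by
    intro x y hxy
    have h (i : ι) : ∃ n : ℤ, (n : ℝ) = y i - x i := by
      have h₀ : ((y i - x i : ℝ) : UnitAddCircle) = 0 := by
        rw [AddCircle.coe_sub, sub_eq_zero]
        exact (congr_fun hxy i).symm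
      simpa using (AddCircle.coe_eq_zero_iff 1).1 h₀
    choose n hn using h
    rw [← sub_add_cancel y x, ← show (fun i ↦ (n i : ℝ)) = y - x from funext hn]
    simp only [G, ContinuousMap.coe_mk]
    rw [← (Equiv.addLeft n).tsum_eq]
    congr! 3 with m
    ext i
    simp
    ring
  let F : C(UnitAddTorus ι, ℂ) := hP.lift G hG
  have hF (x : ι → ℝ) : F (fun i ↦ (x i : UnitAddCircle)) = G x :=
    DFunLike.congr_fun (hP.lift_comp G hG) x
  have hcoeff (k : ι → ℤ) : mFourierCoeff F k =
      ∫ x : ι → ℝ, Complex.exp (-(2 * Real.pi * Complex.I * (∑ i, k i * x i : ℝ))) * f x := by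
    rw [mFourierCoeff_eq_integral F k 0, ← integral_eq_setIntegral_tsum_add_intCast]
    · simp only [Pi.zero_apply, hF, mFourier_coe, smul_eq_mul, G, ContinuousMap.coe_mk,
        ← tsum_mul_left]
      congr! 5 with x m
      rw [Complex.exp_eq_exp_iff_exists_int]
      refine ⟨∑ i, k i * m i, ?_⟩
      simp only [Pi.neg_apply, Pi.add_apply, mul_add, Finset.sum_add_distrib]
      push_cast
      simp only [neg_mul, Finset.sum_neg_distrib]
      ring
    · refine hi.bdd_mul (c := 1) (Continuous.aestronglyMeasurable (by fun_prop)) (ae_of_all _ fun x ↦ le_of_eq ?_)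
      rw [Complex.norm_exp]
      simp [-Complex.ofReal_sum]
  have hsum := hasSum_mFourier_series_apply_of_summable (f := F) (by simpa [funext hcoeff] using hs)
    (fun i ↦ ((0 : ℝ) : UnitAddCircle))
  have h0 := hF 0
  simp only [Pi.zero_apply] at h0
  rw [h0] at hsum
  have h1 (k : ι → ℤ) : mFourier k (fun i ↦ ((0 : ℝ) : UnitAddCircle)) = 1 := by
    simpa using mFourier_coe k 0
  simp only [h1, smul_eq_mul, mul_one, hcoeff] at hsum
  rw [hsum.tsum_eq]
  simp [G]

end PoissonSummation

section Gaussian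

open MeasureTheory Complex

variable {ι : Type*} [Fintype ι]

theorem summable_prod_pi {κ : Type*} {f : κ → ℝ} (hf : Summable f) (h0 : 0 ≤ f) :
    Summable fun m : ι → κ ↦ ∏ i, f (m i) := by
  classical
  refine summable_of_sum_le (c := ∏ _i : ι, ∑' n, f n)
    (fun m ↦ Finset.prod_nonneg fun i _ ↦ h0 _) fun s ↦ ?_
  calc ∑ m ∈ s, ∏ i, f (m i)
      ≤ ∑ m ∈ Fintype.piFinset fun i ↦ s.image fun m ↦ m i, ∏ i, f (m i) :=
        Finset.sum_le_sum_of_subset_of_nonneg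
          (fun m hm ↦ Fintype.mem_piFinset.2 fun i ↦ Finset.mem_image_of_mem _ hm)
          fun m _ _ ↦ Finset.prod_nonneg fun i _ ↦ h0 _
    _ = ∏ i, ∑ n ∈ s.image fun m ↦ m i, f n := (Finset.prod_univ_sum _ _).symm
    _ ≤ ∏ _i : ι, ∑' n, f n := Finset.prod_le_prod
        (fun i _ ↦ Finset.sum_nonneg fun n _ ↦ h0 n) fun i _ ↦ hf.sum_le_tsum _ fun n _ ↦ h0 n

theorem summable_exp_neg_mul_sum_intCast_sq {c : ℝ} (hc : 0 < c) :
    Summable fun m : ι → ℤ ↦ Real.exp (-c * ∑ i, (m i : ℝ) ^ 2) := by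
  have h : Summable fun n : ℤ ↦ Real.exp (-c * (n : ℝ) ^ 2) := by
    have hT : 0 < c / Real.pi := by positivity
    refine (summable_pow_mul_jacobiTheta₂_term_bound 0 hT 0).congr fun n ↦ ?_
    have := Real.pi_ne_zero
    simp only [pow_zero, one_mul, mul_zero, zero_mul, sub_zero]
    congr 1
    field_simp
  simpa only [Finset.mul_sum, Real.exp_sum] using
    summable_prod_pi (ι := ι) h fun n ↦ (Real.exp_pos _).le

theorem Matrix.sum_mulVec_sq_le (B : Matrix ι ι ℝ) (y : ι → ℝ) :
    ∑ i, (B *ᵥ y) i ^ 2 ≤ (∑ i, ∑ j, B i j ^ 2) * ∑ j, y j ^ 2 := by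
  rw [Finset.sum_mul]
  exact Finset.sum_le_sum fun i _ ↦ Finset.sum_mul_sq_le_sq_mul_sq _ _ _

variable [DecidableEq ι] {A : Matrix ι ι ℝ}

theorem Matrix.exists_pos_mul_sum_sq_le (hA : IsUnit A.det) :
    ∃ c : ℝ, 0 < c ∧ ∀ x : ι → ℝ, c * ∑ i, x i ^ 2 ≤ ∑ j, (A *ᵥ x) j ^ 2 := by
  set C : ℝ := ∑ i, ∑ j, A⁻¹ i j ^ 2
  have hC : 0 ≤ C := by positivity
  refine ⟨(C + 1)⁻¹, by positivity, fun x ↦ ?_⟩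
  have h := A⁻¹.sum_mulVec_sq_le (A *ᵥ x)
  rw [mulVec_mulVec, nonsing_inv_mul _ hA, one_mulVec] at h
  rw [inv_mul_le_iff₀ (by positivity)]
  refine h.trans (mul_le_mul_of_nonneg_right (by linarith) (by positivity))

theorem norm_cexp_pi_mul_I_mul (s : ℝ) (z : ℂ) :
    ‖cexp (Real.pi * I * s * z)‖ = Real.exp (-(Real.pi * z.im * s)) := by
  rw [norm_exp]
  congr 1
  simp
  ring

/-- Uniform Gaussian domination of the translates of `x ↦ exp (π i ‖A x‖² z)`. -/
theorem exists_summable_bound_cexp_sum_mulVec_sq (hA : IsUnit A.det) {z : ℂ} (hz : 0 < z.im)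
    (R : ℝ) :
    ∃ u : (ι → ℤ) → ℝ, Summable u ∧ ∀ x ∈ Metric.ball (0 : ι → ℝ) R, ∀ m : ι → ℤ,
      ‖cexp (Real.pi * I * ((∑ j, (A *ᵥ (x + fun i ↦ (m i : ℝ))) j ^ 2 : ℝ) : ℂ) * z)‖ ≤ u m := by
  obtain ⟨c, hc, hcA⟩ := exists_pos_mul_sum_sq_le hA
  set K := Real.pi * z.im * c with hK
  have hK0 : 0 < K := by positivity
  refine ⟨fun m ↦ Real.exp (K * (Fintype.card ι * R ^ 2)) *
    Real.exp (-(K / 2) * ∑ i, (m i : ℝ) ^ 2),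
    (summable_exp_neg_mul_sum_intCast_sq (by positivity)).mul_left _, fun x hx m ↦ ?_⟩
  beta_reduce
  rw [norm_cexp_pi_mul_I_mul, ← Real.exp_add, Real.exp_le_exp]
  have hx' (i : ι) : x i ^ 2 ≤ R ^ 2 := by
    have h : |x i| < R := (norm_le_pi_norm x i).trans_lt (by simpa using hx)
    exact sq_le_sq' (by linarith [abs_lt.1 h]) (by linarith [abs_lt.1 h])
  have h₁ : ∑ i, (m i : ℝ) ^ 2 ≤
      2 * ∑ i, (x + fun i ↦ (m i : ℝ)) i ^ 2 + 2 * (Fintype.card ι * R ^ 2) := by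
    rw [← nsmul_eq_mul, ← Finset.card_univ, ← Finset.sum_const, Finset.mul_sum, Finset.mul_sum,
      ← Finset.sum_add_distrib]
    refine Finset.sum_le_sum fun i _ ↦ ?_
    simp only [Pi.add_apply]
    nlinarith [hx' i, sq_nonneg (2 * x i + m i)]
  have h₂ := mul_le_mul_of_nonneg_left (hcA (x + fun i ↦ (m i : ℝ)))
    (by positivity : 0 ≤ Real.pi * z.im)
  rw [← mul_assoc, ← hK] at h₂
  have h₃ := mul_le_mul_of_nonneg_left h₁ hK0.le
  linarith

theorem summable_cexp_sum_mulVec_sq (hA : IsUnit A.det) {z : ℂ} (hz : 0 < z.im) :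
    Summable fun m : ι → ℤ ↦
      cexp (Real.pi * I * ((∑ j, (A *ᵥ fun i ↦ (m i : ℝ)) j ^ 2 : ℝ) : ℂ) * z) := by
  obtain ⟨u, hu, h⟩ := exists_summable_bound_cexp_sum_mulVec_sq hA hz 1
  exact hu.of_norm_bounded fun m ↦ by simpa using h 0 (by simp) m

theorem integral_comp_mulVec (hA : IsUnit A.det) {g : (ι → ℝ) → ℂ} (hg : Continuous g) :
    ∫ x, g (A *ᵥ x) = ((|A.det| : ℝ) : ℂ)⁻¹ * ∫ y, g y := by
  have h := integral_map (μ := volume) (φ := toLin' A) (f := g)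
    (LinearMap.continuous_of_finiteDimensional _).aemeasurable hg.aestronglyMeasurable
  rw [Real.map_matrix_volume_pi_eq_smul_volume_pi hA.ne_zero, integral_smul_measure,
    ENNReal.toReal_ofReal (abs_nonneg _), abs_inv] at h
  simpa using h.symm

theorem integrable_comp_mulVec (hA : IsUnit A.det) {g : (ι → ℝ) → ℂ} (hg : Integrable g)
    (hc : Continuous g) : Integrable fun x ↦ g (A *ᵥ x) := by
  have h : Integrable g (Measure.map (toLin' A) volume) := by
    rw [Real.map_matrix_volume_pi_eq_smul_volume_pi hA.ne_zero]
    exact hg.smul_measure ENNReal.ofReal_ne_top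
  exact (integrable_map_measure hc.aestronglyMeasurable
    (LinearMap.continuous_of_finiteDimensional _).aemeasurable).1 h

/-- The Fourier transform of the Gaussian `x ↦ exp (π i ‖A x‖² z)`. -/
theorem integral_cexp_sum_mulVec_sq (hA : IsUnit A.det) {z : ℂ} (hz : 0 < z.im) (k : ι → ℤ) :
    ∫ x : ι → ℝ, cexp (-(2 * Real.pi * I * (∑ i, k i * x i : ℝ))) *
        cexp (Real.pi * I * ((∑ j, (A *ᵥ x) j ^ 2 : ℝ) : ℂ) * z) =
      (-I * z) ^ (-(Fintype.card ι : ℂ) / 2) * ((|A.det| : ℝ) : ℂ)⁻¹ *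
        cexp (Real.pi * I * ((∑ j, (Aᵀ⁻¹ *ᵥ fun i ↦ (k i : ℝ)) j ^ 2 : ℝ) : ℂ) * (-z⁻¹)) := by
  set w := Aᵀ⁻¹ *ᵥ fun i ↦ (k i : ℝ) with hw
  have hz0 : z ≠ 0 := by rintro rfl; simp at hz
  have hkw (x : ι → ℝ) : ∑ i, (k i : ℝ) * x i = ∑ j, w j * (A *ᵥ x) j := by
    change (fun i ↦ (k i : ℝ)) ⬝ᵥ x = w ⬝ᵥ (A *ᵥ x)
    rw [dotProduct_mulVec, ← mulVec_transpose, hw, mulVec_mulVec,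
      mul_nonsing_inv _ (by rwa [det_transpose]), one_mulVec]
  have hb : 0 < (-(Real.pi * I * z)).re := by simpa using by positivity
  let g : (ι → ℝ) → ℂ := fun y ↦ cexp (-(-(Real.pi * I * z)) * ∑ i, (y i : ℂ) ^ 2 +
    ∑ i, (-(2 * Real.pi * I * w i)) * y i)
  have hg : (fun x : ι → ℝ ↦ cexp (-(2 * Real.pi * I * (∑ i, k i * x i : ℝ))) *
      cexp (Real.pi * I * ((∑ j, (A *ᵥ x) j ^ 2 : ℝ) : ℂ) * z)) = fun x ↦ g (A *ᵥ x) := by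
    ext x
    dsimp only [g]
    rw [hkw, ← Complex.exp_add]
    simp only [neg_mul, mul_assoc, Finset.sum_neg_distrib, ← Finset.mul_sum]
    push_cast
    ring_nf
  rw [hg, integral_comp_mulVec hA (g := g) (by fun_prop),
    GaussianFourier.integral_cexp_neg_mul_sum_add hb]
  have hre : 0 < (-I * z).re := by simpa using hz
  have hpow : ((Real.pi : ℂ) / -(Real.pi * I * z)) ^ (Fintype.card ι / 2 : ℂ) =
      (-I * z) ^ (-(Fintype.card ι : ℂ) / 2) := by
    have h : (Real.pi : ℂ) / -(Real.pi * I * z) = (-I * z)⁻¹ := by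
      have := Real.pi_ne_zero
      field_simp
    rw [h, inv_cpow, neg_div, cpow_neg]
    intro harg
    exact hre.not_ge (by
      have := (arg_eq_pi_iff.1 harg).1
      exact this.le)
  have hexp : (∑ i, (-(2 * Real.pi * I * w i : ℂ)) ^ 2) / (4 * -(Real.pi * I * z)) =
      Real.pi * I * ((∑ j, w j ^ 2 : ℝ) : ℂ) * (-z⁻¹) := by
    have h : ∑ i, (-(2 * Real.pi * I * w i : ℂ)) ^ 2 =
        -(4 * Real.pi ^ 2) * ((∑ j, w j ^ 2 : ℝ) : ℂ) := by
      push_cast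
      rw [Finset.mul_sum]
      refine Finset.sum_congr rfl fun i _ ↦ ?_
      linear_combination (4 * Real.pi ^ 2 * (w i : ℂ) ^ 2) * I_sq
    have := Real.pi_ne_zero
    rw [h]
    field_simp
    linear_combination ((∑ j, w j ^ 2 : ℝ) : ℂ) * I_sq
  rw [hpow, hexp]
  ring

/-- The transformation law of the theta series of the lattice `A ℤ^ι`. -/
theorem tsum_cexp_sum_mulVec_sq (hA : IsUnit A.det) {z : ℂ} (hz : 0 < z.im) :
    ∑' m : ι → ℤ, cexp (Real.pi * I * ((∑ j, (A *ᵥ fun i ↦ (m i : ℝ)) j ^ 2 : ℝ) : ℂ) * z) =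
      (-I * z) ^ (-(Fintype.card ι : ℂ) / 2) * ((|A.det| : ℝ) : ℂ)⁻¹ * ∑' k : ι → ℤ,
        cexp (Real.pi * I * ((∑ j, (Aᵀ⁻¹ *ᵥ fun i ↦ (k i : ℝ)) j ^ 2 : ℝ) : ℂ) * (-z⁻¹)) := by
  have hz' : 0 < (-z⁻¹).im := by
    have : z ≠ 0 := by rintro rfl; simp at hz
    rw [neg_im, inv_im, neg_div, neg_neg]
    exact div_pos hz (normSq_pos.2 this)
  have hA' : IsUnit (Aᵀ⁻¹).det := isUnit_nonsing_inv_det _ (by rwa [det_transpose])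
  rw [← tsum_mul_left]
  simp only [← integral_cexp_sum_mulVec_sq hA hz]
  refine tsum_intCast_eq_tsum_integral
    (f := fun x ↦ cexp (Real.pi * I * ((∑ j, (A *ᵥ x) j ^ 2 : ℝ) : ℂ) * z))
    (by fun_prop) ?_ (exists_summable_bound_cexp_sum_mulVec_sq hA hz) ?_
  · refine integrable_comp_mulVec hA
      (g := fun y ↦ cexp (Real.pi * I * ((∑ j, y j ^ 2 : ℝ) : ℂ) * z)) ?_ (by fun_prop)
    have hb : 0 < (-(Real.pi * I * z)).re := by simpa using by positivity
    convert! GaussianFourier.integrable_cexp_neg_mul_sum_add hb (0 : ι → ℂ) using 3 with y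
    simp
    ring
  · simp only [integral_cexp_sum_mulVec_sq hA hz]
    exact (summable_cexp_sum_mulVec_sq hA' hz').mul_left _

end Gaussian

/-- **Theta-null transformation formula** (slice form of the `w = 0` case of Theorem 4.7):
for `d ≥ 1` and `A` an invertible real `d × d` matrix, with
`θ_L(z) = ∑_{m∈ℤ^d} exp(πi‖Am‖² z)` and `θ_{L^♯}(z) = ∑_{k∈ℤ^d} exp(πi‖(Aᵀ)⁻¹k‖² z)`,
one has `θ_L(z) = (−iz)^{−d/2} |det A|⁻¹ θ_{L^♯}(−z⁻¹)` for every `Im z > 0`. -/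
theorem theta_null_transformation (d : ℕ) (hd : 1 ≤ d)
    (A : Matrix (Fin d) (Fin d) ℝ) (hA : IsUnit A.det)
    (θL θLdual : ℂ → ℂ)
    (hθL : ∀ z : ℂ, 0 < z.im → θL z = ∑' m : Fin d → ℤ,
      Complex.exp ((Real.pi : ℂ) * Complex.I *
        ((∑ j, (A.mulVec (fun i => (m i : ℝ)) j) ^ 2 : ℝ) : ℂ) * z))
    (hθLdual : ∀ z : ℂ, 0 < z.im → θLdual z = ∑' k : Fin d → ℤ,
      Complex.exp ((Real.pi : ℂ) * Complex.I *
        ((∑ j, ((Aᵀ)⁻¹.mulVec (fun i => (k i : ℝ)) j) ^ 2 : ℝ) : ℂ) * z))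
    (z : ℂ) (hz : 0 < z.im) :
    θL z = (-Complex.I * z) ^ (-(d : ℂ) / 2) * ((|A.det| : ℝ)⁻¹ : ℂ) * θLdual (-z⁻¹) := by
  have hz' : 0 < (-z⁻¹).im := by
    rw [Complex.neg_im, Complex.inv_im, neg_div, neg_neg]
    exact div_pos hz (Complex.normSq_pos.2 fun h ↦ by simp [h] at hz)
  rw [hθL z hz, hθLdual _ hz', tsum_cexp_sum_mulVec_sq hA hz, Fintype.card_fin]
end

section
/- Second conjugated theta relation (slice form of equation (4.15)): let d ≥ 1 and let A be an invertible real d×d matrix whose lattice L = A·ℤ^d is self-dual, i.e. A·ℤ^d = (Aᵀ)⁻¹·ℤ^d. Fix q̃ = (1/2)·A·m₀ for some m₀ ∈ ℤ^d. Then for every z ∈ ℂ with Im z > 0: ∑_{m∈ℤ^d} exp(πi‖Am‖²·z + 2πi⟨Am, q̃⟩) = (−iz)^{−d/2} · ∑_{m∈ℤ^d} exp(πi‖Am + q̃‖²·(−z⁻¹)). -/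
open Matrix

/-- A product of nonnegative summable families is summable over the index functions. -/
lemma summable_pi_prod {ι κ : Type*} [Fintype ι] {g : κ → ℝ} (hg : ∀ k, 0 ≤ g k)
    (hs : Summable g) : Summable fun m : ι → κ => ∏ i, g (m i) := by
  classical
  refine summable_of_sum_le (c := ∏ _i : ι, ∑' k, g k)
    (fun m => Finset.prod_nonneg fun i _ => hg _) fun s => ?_
  calc ∑ m ∈ s, ∏ i, g (m i)
      ≤ ∑ m ∈ Fintype.piFinset fun i => s.image (· i), ∏ i, g (m i) := by
        refine Finset.sum_le_sum_of_subset_of_nonneg (fun m hm => ?_)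
          fun m _ _ => Finset.prod_nonneg fun i _ => hg _
        exact Fintype.mem_piFinset.2 fun i => Finset.mem_image_of_mem _ hm
    _ = ∏ i, ∑ k ∈ s.image (· i), g k := (Finset.prod_univ_sum _ _).symm
    _ ≤ ∏ _i : ι, ∑' k, g k :=
        Finset.prod_le_prod (fun i _ => Finset.sum_nonneg fun k _ => hg k)
          fun i _ => hs.sum_le_tsum _ fun k _ => hg k

lemma summable_exp_neg_mul_int_sq {β : ℝ} (hβ : 0 < β) :
    Summable fun n : ℤ => Real.exp (-β * (n : ℝ) ^ 2) := by
  have h : Summable fun n : ℕ => Real.exp (-β * (n : ℝ) ^ 2) := by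
    have := Real.summable_exp_nat_mul_iff.2 (neg_lt_zero.2 hβ)
    refine Summable.of_nonneg_of_le (fun _ => (Real.exp_pos _).le) (fun n => ?_) this
    refine Real.exp_le_exp.2 ?_
    have : (n : ℝ) ≤ (n : ℝ) ^ 2 := by exact_mod_cast Nat.le_self_pow two_ne_zero n
    nlinarith
  refine Summable.of_nat_of_neg ?_ ?_ <;> simpa using h

lemma sum_sq_le_mul_sum_mulVec_sq {ι : Type*} [Fintype ι] [DecidableEq ι]
    {M : Matrix ι ι ℝ} (hM : IsUnit M.det) :
    ∃ c > 0, ∀ x : ι → ℝ, c * ∑ i, x i ^ 2 ≤ ∑ j, (M *ᵥ x) j ^ 2 := by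
  set K : ℝ := ∑ i, ∑ j, M⁻¹ i j ^ 2
  have hK : 0 ≤ K := Finset.sum_nonneg fun i _ => Finset.sum_nonneg fun j _ => sq_nonneg _
  refine ⟨(K + 1)⁻¹, by positivity, fun x => ?_⟩
  rw [inv_mul_le_iff₀ (by positivity)]
  have hx : ∀ i, x i = ∑ j, M⁻¹ i j * (M *ᵥ x) j := fun i => by
    change x i = (M⁻¹ *ᵥ (M *ᵥ x)) i
    rw [mulVec_mulVec, nonsing_inv_mul _ hM, one_mulVec]
  have h0 : 0 ≤ ∑ j, (M *ᵥ x) j ^ 2 := Finset.sum_nonneg fun j _ => sq_nonneg _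
  calc ∑ i, x i ^ 2 ≤ ∑ i, (∑ j, M⁻¹ i j ^ 2) * ∑ j, (M *ᵥ x) j ^ 2 :=
        Finset.sum_le_sum fun i _ => by
          rw [hx i]; exact Finset.sum_mul_sq_le_sq_mul_sq _ _ _
    _ = K * ∑ j, (M *ᵥ x) j ^ 2 := by rw [← Finset.sum_mul]
    _ ≤ _ := by nlinarith

lemma exists_summable_bound_exp_neg_quadratic {ι : Type*} [Fintype ι] [DecidableEq ι]
    {M : Matrix ι ι ℝ} (hM : IsUnit M.det) {β : ℝ} (hβ : 0 < β) (R : ℝ) :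
    ∃ u : (ι → ℤ) → ℝ, Summable u ∧ ∀ (m : ι → ℤ) (x : ι → ℝ), (∀ i, |x i| ≤ R) →
      Real.exp (-β * ∑ j, (M *ᵥ fun i => x i + m i) j ^ 2) ≤ u m := by
  obtain ⟨c, hc, hcM⟩ := sum_sq_le_mul_sum_mulVec_sq hM
  have hs := (summable_pi_prod (ι := ι) (fun n => (Real.exp_pos _).le)
    (summable_exp_neg_mul_int_sq (β := β * c / 2) (by positivity))).mul_left
    (Real.exp (β * c * ∑ _i : ι, R ^ 2))
  refine ⟨_, hs, fun m x hx => ?_⟩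
  rw [← Real.exp_sum, ← Real.exp_add, Real.exp_le_exp, ← Finset.mul_sum]
  have h1 : ∑ i, ((m i : ℝ) ^ 2 / 2 - R ^ 2) ≤ ∑ i, (x i + m i) ^ 2 :=
    Finset.sum_le_sum fun i _ => by
      have := sq_le_sq' (neg_le_of_abs_le (hx i)) (le_of_abs_le (hx i))
      nlinarith [sq_nonneg (2 * x i + m i)]
  rw [Finset.sum_sub_distrib, ← Finset.sum_div] at h1
  have h2 := hcM fun i => x i + m i
  have h3 := mul_le_mul_of_nonneg_left (h2.trans' (mul_le_mul_of_nonneg_left h1 hc.le)) hβ.le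
  linarith

section Poisson
open MeasureTheory

/-- Unfolding: the integral over `ℝᵈ` is the sum of the integrals over the translates of a box. -/
lemma hasSum_integral_box_add_int {ι E : Type*} [Fintype ι] [NormedAddCommGroup E]
    [NormedSpace ℝ E] {h : (ι → ℝ) → E} (hh : Integrable h) :
    HasSum (fun m : ι → ℤ => ∫ x in {x : ι → ℝ | ∀ i, x i ∈ Set.Ioc (0 : ℝ) (0 + 1)},
      h (fun i => x i + m i)) (∫ x, h x) := by
  set S : (ι → ℤ) → Set (ι → ℝ) := fun m => {x | ∀ i, x i ∈ Set.Ioc (m i : ℝ) (m i + 1)}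
  have hS : ∀ m, MeasurableSet (S m) := fun m =>
    MeasurableSet.univ_pi' fun i => measurableSet_Ioc
  have hmem : ∀ m x, x ∈ S m → m = fun i => ⌈x i⌉ - 1 := fun m x hx => by
    funext i
    have : ⌈x i⌉ = m i + 1 := Int.ceil_eq_iff.2 ⟨by simpa using (hx i).1, by simpa using (hx i).2⟩
    omega
  have hd : Pairwise (Function.onFun Disjoint S) := fun m n hmn =>
    Set.disjoint_left.2 fun x hm hn => hmn ((hmem m x hm).trans (hmem n x hn).symm)
  have hU : ⋃ m, S m = Set.univ := Set.eq_univ_of_forall fun x =>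
    Set.mem_iUnion.2 ⟨fun i => ⌈x i⌉ - 1, fun i => by
      have := Int.ceil_lt_add_one (x i)
      have := Int.le_ceil (x i)
      constructor <;> push_cast <;> linarith⟩
  have key := hasSum_integral_iUnion (μ := volume) hS hd (f := h) hh.integrableOn
  rw [hU, setIntegral_univ] at key
  convert key using 2 with m
  rw [← (measurePreserving_add_right volume fun i => (m i : ℝ)).setIntegral_preimage_emb
    (measurableEmbedding_addRight _) h (S m)]
  congr 2
  ext x
  simp only [S, Set.mem_preimage, Set.mem_ofPred_eq, Set.mem_Ioc, Pi.add_apply]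
  refine forall_congr' fun i => and_congr ?_ ?_ <;> constructor <;> intro <;> linarith

/-- **Poisson summation** on `ℝᵈ`. -/
theorem tsum_add_int_eq_tsum_integral_mul_mFourier {ι : Type*} [Fintype ι]
    {f : (ι → ℝ) → ℂ} (hf : Continuous f) (hint : Integrable f)
    (hb : ∀ R : ℝ, ∃ u : (ι → ℤ) → ℝ, Summable u ∧ ∀ (m : ι → ℤ) (x : ι → ℝ),
      (∀ i, |x i| ≤ R) → ‖f fun i => x i + m i‖ ≤ u m)
    (hF : Summable fun k : ι → ℤ =>
      ∫ y : ι → ℝ, UnitAddTorus.mFourier (-k) (fun i => (y i : UnitAddCircle)) * f y)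
    (x : ι → ℝ) :
    ∑' m : ι → ℤ, f (fun i => x i + m i) =
      ∑' k : ι → ℤ,
        (∫ y : ι → ℝ, UnitAddTorus.mFourier (-k) (fun i => (y i : UnitAddCircle)) * f y) *
          UnitAddTorus.mFourier k fun i => (x i : UnitAddCircle) := by
  have hcont : Continuous fun x : ι → ℝ => ∑' m : ι → ℤ, f fun i => x i + m i := by
    refine continuous_iff_continuousAt.2 fun x₀ => ?_
    obtain ⟨u, hu, hle⟩ := hb (‖x₀‖ + 1)
    have hon : ContinuousOn (fun x : ι → ℝ => ∑' m : ι → ℤ, f fun i => x i + m i)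
        (Metric.ball 0 (‖x₀‖ + 1)) := by
      refine continuousOn_tsum (fun m => (hf.comp (by fun_prop)).continuousOn) hu
        fun m x hx => hle m x fun i => ?_
      exact (norm_le_pi_norm x i).trans ((mem_ball_zero_iff.1 hx).le)
    exact hon.continuousAt (Metric.isOpen_ball.mem_nhds (by simp))
  have hq : IsOpenQuotientMap fun (y : ι → ℝ) (i : ι) => (y i : UnitAddCircle) :=
    IsOpenQuotientMap.piMap fun _ => QuotientAddGroup.isOpenQuotientMap_mk
  let q : C(ι → ℝ, UnitAddTorus ι) := ⟨_, hq.continuous⟩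
  have hqq : Topology.IsQuotientMap q := hq.isQuotientMap
  have hfac : Function.FactorsThrough (⟨_, hcont⟩ : C(ι → ℝ, ℂ)) q := fun a b hab => by
    have : ∀ i, ∃ n : ℤ, b i = a i + n := fun i => by
      obtain ⟨n, hn⟩ := (QuotientAddGroup.eq.1 (congrFun hab i) :
        -a i + b i ∈ AddSubgroup.zmultiples (1 : ℝ))
      exact ⟨n, by simp at hn; linarith⟩
    choose n hn using this
    change ∑' m : ι → ℤ, f (fun i => a i + m i) = ∑' m : ι → ℤ, f (fun i => b i + m i)
    rw [← (Equiv.addLeft n).tsum_eq]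
    simp [hn, add_assoc]
  let F : C(UnitAddTorus ι, ℂ) := hqq.lift ⟨_, hcont⟩ hfac
  have hFq : ∀ y : ι → ℝ, F (fun i => (y i : UnitAddCircle)) =
      ∑' m : ι → ℤ, f fun i => y i + m i := fun y => by
    exact DFunLike.congr_fun (hqq.lift_comp ⟨_, hcont⟩ hfac) y
  have hcoeff : ∀ k : ι → ℤ, UnitAddTorus.mFourierCoeff F k =
      ∫ y : ι → ℝ, UnitAddTorus.mFourier (-k) (fun i => (y i : UnitAddCircle)) * f y := by
    intro k
    rw [UnitAddTorus.mFourierCoeff_eq_integral F k 0]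
    simp_rw [hFq, smul_eq_mul, ← tsum_mul_left]
    set g : (ι → ℝ) → ℂ :=
      fun y => UnitAddTorus.mFourier (-k) (fun i => (y i : UnitAddCircle)) * f y
    have hg : Integrable g := by
      refine hint.bdd_mul (c := 1) ?_ ?_
      · exact ((UnitAddTorus.mFourier (-k)).continuous.comp q.continuous).aestronglyMeasurable
      · exact .of_forall fun y => by
          exact (ContinuousMap.norm_coe_le_norm _ _).trans UnitAddTorus.mFourier_norm.le
    have hper : ∀ (y : ι → ℝ) (m : ι → ℤ),
        UnitAddTorus.mFourier (-k) (fun i => (y i : UnitAddCircle)) * f (fun i => y i + m i) =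
          g fun i => y i + m i := fun y m => by
      simp only [g]
      congr 2
      funext i
      simp
    simp_rw [hper]
    have h1 := hasSum_integral_box_add_int hg
    have h2 := hasSum_integral_box_add_int hg.norm
    have h3 := hasSum_integral_of_summable_integral_norm
      (μ := volume.restrict {x : ι → ℝ | ∀ i, x i ∈ Set.Ioc (0 : ℝ) (0 + 1)})
      (F := fun (m : ι → ℤ) y => g fun i => y i + m i)
      (fun m => ((measurePreserving_add_right volume fun i => (m i : ℝ)).integrable_comp_emb
        (measurableEmbedding_addRight _)).2 hg |>.integrableOn) h2.summable
    exact h3.unique h1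
  have hsum : Summable (UnitAddTorus.mFourierCoeff F) := by
    rwa [funext hcoeff]
  have := (UnitAddTorus.hasSum_mFourier_series_apply_of_summable hsum
    fun i => (x i : UnitAddCircle)).tsum_eq
  rw [← hFq, ← this]
  simp_rw [hcoeff, smul_eq_mul]

lemma measurePreserving_mulVec {ι : Type*} [Fintype ι] [DecidableEq ι] {M : Matrix ι ι ℝ}
    (hM : |M.det| = 1) : MeasurePreserving fun x : ι → ℝ => M *ᵥ x := by
  refine ⟨by fun_prop, ?_⟩
  have h0 : M.det ≠ 0 := fun h => by simp [h] at hM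
  have := Real.map_matrix_volume_pi_eq_smul_volume_pi h0
  rwa [abs_inv, hM, inv_one, ENNReal.ofReal_one, one_smul] at this

lemma mFourier_coe_apply {ι : Type*} [Fintype ι] (k : ι → ℤ) (x : ι → ℝ) :
    UnitAddTorus.mFourier k (fun i => (x i : UnitAddCircle)) =
      Complex.exp (2 * Real.pi * Complex.I * ((∑ i, k i * x i : ℝ) : ℂ)) := by
  simp only [UnitAddTorus.mFourier, ContinuousMap.coe_mk, fourier_coe_apply, ← Complex.exp_sum]
  push_cast
  rw [Finset.mul_sum]
  congr 1
  exact Finset.sum_congr rfl fun i _ => by ring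

lemma integrable_cexp_neg_mul_quadratic {ι : Type*} [Fintype ι] [DecidableEq ι]
    {M : Matrix ι ι ℝ} (hM : |M.det| = 1) {b : ℂ} (hb : 0 < b.re) :
    Integrable fun y : ι → ℝ => Complex.exp (-b * ((∑ j, (M *ᵥ y) j ^ 2 : ℝ) : ℂ)) := by
  have h := GaussianFourier.integrable_cexp_neg_mul_sum_add hb (fun _ : ι => (0 : ℂ))
  have := (measurePreserving_mulVec hM).integrable_comp h.aestronglyMeasurable |>.2 h
  simpa [Function.comp_def] using this

lemma integral_mFourier_mul_cexp_neg_mul_quadratic {ι : Type*} [Fintype ι] [DecidableEq ι]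
    {M : Matrix ι ι ℝ} (hM : |M.det| = 1) {b : ℂ} (hb : 0 < b.re) (k : ι → ℤ) :
    ∫ y : ι → ℝ, UnitAddTorus.mFourier (-k) (fun i => (y i : UnitAddCircle)) *
        Complex.exp (-b * ((∑ j, (M *ᵥ y) j ^ 2 : ℝ) : ℂ)) =
      (Real.pi / b) ^ (Fintype.card ι / 2 : ℂ) *
        Complex.exp (-(Real.pi ^ 2 / b) *
          ((∑ j, ((Mᵀ)⁻¹ *ᵥ fun i => (k i : ℝ)) j ^ 2 : ℝ) : ℂ)) := by
  have hu : IsUnit Mᵀ.det := by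
    rw [det_transpose, isUnit_iff_ne_zero]
    exact fun h => by simp [h] at hM
  have hu' : IsUnit M.det := by rwa [det_transpose] at hu
  set l : ι → ℝ := (Mᵀ)⁻¹ *ᵥ fun i => (k i : ℝ)
  have hl : ∀ y : ι → ℝ, ∑ i, l i * (M *ᵥ y) i = ∑ i, k i * y i := fun y => by
    change l ⬝ᵥ M *ᵥ y = (fun i => (k i : ℝ)) ⬝ᵥ y
    rw [dotProduct_mulVec, ← mulVec_transpose, mulVec_mulVec, mul_nonsing_inv _ hu, one_mulVec]
  have h := GaussianFourier.integral_cexp_neg_mul_sum_add hb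
    (fun i => -(2 * Real.pi * Complex.I) * l i)
  have hemb : MeasurableEmbedding fun y : ι → ℝ => M *ᵥ y :=
    Continuous.measurableEmbedding (by fun_prop) (mulVec_injective_of_isUnit
      ((isUnit_iff_isUnit_det M).2 hu'))
  rw [← (measurePreserving_mulVec hM).integral_comp hemb] at h
  refine Eq.trans (integral_congr_ae (.of_forall fun y => ?_)) (h.trans (congrArg _ ?_))
  · beta_reduce
    rw [mFourier_coe_apply, ← Complex.exp_add]
    have : (∑ i, ((-k) i : ℤ) * y i : ℝ) = -∑ i, l i * (M *ᵥ y) i := by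
      rw [hl]; simp
    rw [this]
    push_cast
    simp_rw [mul_assoc, ← Finset.mul_sum]
    congr 1
    ring
  · push_cast
    simp_rw [mul_pow, ← Finset.mul_sum]
    congr 1
    rw [neg_sq, mul_pow, mul_pow, Complex.I_sq]
    field_simp
    ring

/-- The theta transformation formula for the lattice `M·ℤᵈ` of covolume one. -/
theorem tsum_cexp_neg_mul_quadratic_add_int {ι : Type*} [Fintype ι] [DecidableEq ι]
    {M : Matrix ι ι ℝ} (hM : |M.det| = 1) {b : ℂ} (hb : 0 < b.re) (x : ι → ℝ) :
    ∑' m : ι → ℤ, Complex.exp (-b * ((∑ j, (M *ᵥ fun i => x i + m i) j ^ 2 : ℝ) : ℂ)) =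
      (Real.pi / b) ^ (Fintype.card ι / 2 : ℂ) * ∑' k : ι → ℤ,
        Complex.exp (-(Real.pi ^ 2 / b) *
            ((∑ j, ((Mᵀ)⁻¹ *ᵥ fun i => (k i : ℝ)) j ^ 2 : ℝ) : ℂ) +
          2 * Real.pi * Complex.I * ((∑ i, k i * x i : ℝ) : ℂ)) := by
  have hu : IsUnit M.det := isUnit_iff_ne_zero.2 fun h => by simp [h] at hM
  have hu' : IsUnit ((Mᵀ)⁻¹).det := by
    rw [det_nonsing_inv, det_transpose]; exact hu.ringInverse
  have hre : 0 < (Real.pi ^ 2 / b : ℂ).re := by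
    rw [div_eq_mul_inv, ← Complex.ofReal_pow, Complex.re_ofReal_mul, Complex.inv_re]
    have : b ≠ 0 := fun h => by simp [h] at hb
    have := Complex.normSq_pos.2 this
    positivity
  have hnorm : ∀ (c : ℂ) (t : ℝ), ‖Complex.exp (-c * (t : ℂ))‖ = Real.exp (-c.re * t) :=
    fun c t => by rw [Complex.norm_exp, Complex.re_mul_ofReal, Complex.neg_re]
  rw [tsum_add_int_eq_tsum_integral_mul_mFourier (by fun_prop)
    (integrable_cexp_neg_mul_quadratic hM hb)
    (fun R => by simpa only [hnorm] using exists_summable_bound_exp_neg_quadratic hu hb R),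
    ← tsum_mul_left]
  · refine tsum_congr fun k => ?_
    rw [integral_mFourier_mul_cexp_neg_mul_quadratic hM hb, mFourier_coe_apply, mul_assoc,
      ← Complex.exp_add]
  · simp_rw [integral_mFourier_mul_cexp_neg_mul_quadratic hM hb]
    refine Summable.mul_left _ ?_
    obtain ⟨u, hs, hle⟩ := exists_summable_bound_exp_neg_quadratic hu' hre 0
    refine Summable.of_norm_bounded hs fun k => ?_
    rw [hnorm]
    simpa using hle k 0 (by simp)

end Poisson

lemma abs_det_eq_one_of_range_eq {ι : Type*} [Fintype ι] [DecidableEq ι]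
    {A : Matrix ι ι ℝ} (hA : IsUnit A.det)
    (hself : (Set.range fun m : ι → ℤ => A *ᵥ fun i => (m i : ℝ))
      = Set.range fun k : ι → ℤ => (Aᵀ)⁻¹ *ᵥ fun i => (k i : ℝ)) : |A.det| = 1 := by
  have hAt : IsUnit Aᵀ.det := by rwa [det_transpose]
  have key : ∀ {B C : Matrix ι ι ℝ}, ((Set.range fun m : ι → ℤ => B *ᵥ fun i => (m i : ℝ))
      ⊆ Set.range fun k : ι → ℤ => C *ᵥ fun i => (k i : ℝ)) →
      ∃ P : Matrix ι ι ℤ, B = C * P.map (Int.castRingHom ℝ) := fun {B C} h => by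
    choose p hp using fun j : ι => h ⟨Pi.single j 1, rfl⟩
    refine ⟨of fun i j => p j i, ?_⟩
    ext i j
    have h1 := congrFun (hp j) i
    have h2 : (fun i => ((Pi.single j 1 : ι → ℤ) i : ℝ)) = Pi.single j 1 := by
      ext i; simp [Pi.single_apply]
    simp only [h2, mulVec_single_one, col_apply] at h1
    rw [← h1]
    rfl
  obtain ⟨P, hP⟩ := key hself.le
  obtain ⟨Q, hQ⟩ := key hself.ge
  have hP' : Aᵀ * A = P.map (Int.castRingHom ℝ) := by
    conv_lhs => rw [congrArg (Aᵀ * ·) hP]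
    rw [← Matrix.mul_assoc, mul_nonsing_inv _ hAt, Matrix.one_mul]
  have h1 : A.det ^ 2 = (P.det : ℝ) := by
    have := congrArg det hP'
    rw [det_mul, det_transpose, ← RingHom.mapMatrix_apply, ← RingHom.map_det] at this
    simpa [sq] using this
  have h2 : A.det ^ 2 * (Q.det : ℝ) = 1 := by
    have := congrArg (fun B => (Aᵀ * B).det) hQ
    simp only [mul_nonsing_inv _ hAt, det_one, det_mul, det_transpose,
      ← RingHom.mapMatrix_apply, ← RingHom.map_det] at this
    rw [this, sq, mul_assoc]; rfl
  have h3 : P.det * Q.det = 1 := by exact_mod_cast h1 ▸ h2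
  have h4 : P.det = 1 := by
    rcases Int.eq_one_or_neg_one_of_mul_eq_one h3 with h | h
    · exact h
    · have := sq_nonneg A.det
      rw [h1, h] at this
      norm_num at this
  rw [h4, Int.cast_one, ← sq_abs] at h1
  exact (pow_eq_one_iff_of_nonneg (abs_nonneg _) two_ne_zero).1 h1

/-- **Second conjugated theta relation** (slice form of equation (4.15)): for a self-dual
lattice `L = A·ℤ^d` and `q̃ = (1/2)·A·m₀`, for every `z` with `Im z > 0`,
`∑_{m∈ℤ^d} exp(πi‖Am‖²z + 2πi⟨Am,q̃⟩) = (−iz)^{−d/2} ∑_{m∈ℤ^d} exp(πi‖Am+q̃‖²(−z⁻¹))`. -/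
theorem second_conjugated_theta_relation (d : ℕ) (hd : 1 ≤ d)
    (A : Matrix (Fin d) (Fin d) ℝ) (hA : IsUnit A.det)
    (hself : (Set.range fun m : Fin d → ℤ => A.mulVec fun i => (m i : ℝ))
      = Set.range fun k : Fin d → ℤ => (Aᵀ)⁻¹.mulVec fun i => (k i : ℝ))
    (m₀ : Fin d → ℤ) (qt : Fin d → ℝ)
    (hqt : qt = (1 / 2 : ℝ) • A.mulVec fun i => (m₀ i : ℝ))
    (z : ℂ) (hz : 0 < z.im) :
    ∑' m : Fin d → ℤ,
        Complex.exp ((Real.pi : ℂ) * Complex.I *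
            ((∑ j, (A.mulVec (fun i => (m i : ℝ)) j) ^ 2 : ℝ) : ℂ) * z
          + 2 * (Real.pi : ℂ) * Complex.I *
            ((∑ j, A.mulVec (fun i => (m i : ℝ)) j * qt j : ℝ) : ℂ))
      = (-Complex.I * z) ^ (-(d : ℂ) / 2) *
        ∑' m : Fin d → ℤ,
          Complex.exp ((Real.pi : ℂ) * Complex.I *
            ((∑ j, (A.mulVec (fun i => (m i : ℝ)) j + qt j) ^ 2 : ℝ) : ℂ) * (-z⁻¹)) := by
  
  have hdet := abs_det_eq_one_of_range_eq hA hself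
  have hAt : IsUnit Aᵀ.det := by rwa [det_transpose]
  have hz0 : z ≠ 0 := fun h => by simp [h] at hz
  have hre : 0 < (-Complex.I * z).re := by simpa using hz
  have hw0 : -Complex.I * z ≠ 0 := fun h => by simp [h] at hre
  set b : ℂ := Real.pi / (-Complex.I * z) with hbdef
  have hb : 0 < b.re := by
    rw [hbdef, div_eq_mul_inv, Complex.re_ofReal_mul, Complex.inv_re]
    exact mul_pos Real.pi_pos (div_pos hre (Complex.normSq_pos.2 hw0))
  have hb1 : (Real.pi : ℂ) / b = -Complex.I * z := by rw [hbdef]; field_simp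
  have hb2 : -((Real.pi : ℂ) ^ 2 / b) = Real.pi * Complex.I * z := by rw [hbdef]; field_simp
  have hb3 : -b = Real.pi * Complex.I * (-z⁻¹) := by
    rw [hbdef]; field_simp; simp
  have key := tsum_cexp_neg_mul_quadratic_add_int hdet hb fun i => (m₀ i : ℝ) / 2
  rw [hb1, hb2, hb3] at key
  have hqt' : qt = A *ᵥ fun i => (m₀ i : ℝ) / 2 := by
    rw [hqt, ← mulVec_smul]
    congr 1
    ext i
    simp only [Pi.smul_apply, smul_eq_mul]
    ring
  have hshift : ∀ (m : Fin d → ℤ) (j : Fin d), A.mulVec (fun i => (m i : ℝ)) j + qt j =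
      (A *ᵥ fun i => (m₀ i : ℝ) / 2 + m i) j := fun m j => by
    rw [hqt', add_comm, ← Pi.add_apply, ← mulVec_add]
    rfl
  have hpair : ∀ k : Fin d → ℤ, ∑ i, (k i : ℝ) * ((m₀ i : ℝ) / 2) =
      ∑ j, ((Aᵀ)⁻¹ *ᵥ fun i => (k i : ℝ)) j * qt j := fun k => by
    change (fun i => (k i : ℝ)) ⬝ᵥ (fun i => (m₀ i : ℝ) / 2) =
      ((Aᵀ)⁻¹ *ᵥ fun i => (k i : ℝ)) ⬝ᵥ qt
    rw [hqt', dotProduct_mulVec, ← mulVec_transpose, mulVec_mulVec, mul_nonsing_inv _ hAt,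
      one_mulVec]
  have hinj : ∀ {B : Matrix (Fin d) (Fin d) ℝ}, IsUnit B.det →
      Function.Injective fun m : Fin d → ℤ => B *ᵥ fun i => (m i : ℝ) := fun hB m n h => by
    have := mulVec_injective_of_isUnit ((isUnit_iff_isUnit_det _).2 hB) h
    exact funext fun i => by exact_mod_cast congrFun this i
  let G : (Fin d → ℝ) → ℂ := fun v => Complex.exp ((Real.pi : ℂ) * Complex.I *
    ((∑ j, v j ^ 2 : ℝ) : ℂ) * z + 2 * (Real.pi : ℂ) * Complex.I * ((∑ j, v j * qt j : ℝ) : ℂ))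
  have hG : ∑' k : Fin d → ℤ, G ((Aᵀ)⁻¹ *ᵥ fun i => (k i : ℝ)) =
      ∑' m : Fin d → ℤ, G (A *ᵥ fun i => (m i : ℝ)) := by
    rw [← tsum_range G (hinj hA), hself, tsum_range G (hinj _)]
    rw [det_nonsing_inv]
    exact hAt.ringInverse
  simp_rw [hshift, mul_right_comm (Real.pi * Complex.I) _ (-z⁻¹)]
  rw [key]
  simp_rw [hpair]
  rw [← mul_assoc, ← Complex.cpow_add _ _ hw0, Fintype.card_fin, neg_div, neg_add_cancel,
    Complex.cpow_zero, one_mul]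
  simp only [G] at hG
  rw [← hG]
  exact tsum_congr fun k => by congr 2; ring
end

section
/- Transformation law of the generalized modular discriminant (slice form of the computation following Definition 4.21): let d ≥ 1 and let A be an invertible real d×d matrix whose lattice L = A·ℤ^d is self-dual, and fix q̃ = (1/2)·A·m₀ for some m₀ ∈ ℤ^d. Define, for Im z > 0, Δ_q̃(z) = (θ(z)·θ̃_q̃(z)·θ̃̃_q̃(z))^8, where θ(z) = ∑_{m∈ℤ^d} exp(πi‖Am‖²·z), θ̃_q̃(z) = ∑_{m∈ℤ^d} exp(πi‖Am‖²·z + 2πi⟨Am, q̃⟩), and θ̃̃_q̃(z) = ∑_{m∈ℤ^d} exp(πi‖Am + q̃‖²·z). Then for every z with Im z > 0: Δ_q̃(z) = (−iz)^{−12d} · Δ_q̃(−z⁻¹). -/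
open Matrix

/-- The quadratic form `v ↦ vᵀ Q v` attached to a real matrix. -/
def quadForm {d : ℕ} (Q : Matrix (Fin d) (Fin d) ℝ) (v : Fin d → ℝ) : ℝ :=
  ∑ i, ∑ j, v i * Q i j * v j

/-- A symmetric matrix whose quadratic form is bounded below by a multiple of the squared norm. -/
structure IsCoerciveForm {d : ℕ} (Q : Matrix (Fin d) (Fin d) ℝ) : Prop where
  symm : ∀ i j, Q i j = Q j i
  bound : ∃ ε > 0, ∀ v : Fin d → ℝ, ε * ∑ i, v i ^ 2 ≤ quadForm Q v

lemma quadForm_succ {d : ℕ} {Q : Matrix (Fin (d + 1)) (Fin (d + 1)) ℝ}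
    (hQ : ∀ i j, Q i j = Q j i) (v : Fin (d + 1) → ℝ) :
    quadForm Q v = Q 0 0 * v 0 ^ 2 + 2 * v 0 * ∑ j : Fin d, Q 0 j.succ * v j.succ
      + quadForm (Q.submatrix Fin.succ Fin.succ) (fun i => v i.succ) := by
  simp only [quadForm, Fin.sum_univ_succ, Finset.sum_add_distrib, submatrix_apply, Finset.mul_sum]
  have h : ∀ i : Fin d, v i.succ * Q i.succ 0 * v 0 = v 0 * Q 0 i.succ * v i.succ := fun i => by
    rw [hQ]; ring
  have h' : ∀ i : Fin d,
      2 * v 0 * (Q 0 i.succ * v i.succ) = 2 * (v 0 * Q 0 i.succ * v i.succ) := fun i => by ring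
  simp only [h, h', ← Finset.mul_sum]
  ring

lemma quadForm_sub_smul {d : ℕ} {W : Matrix (Fin d) (Fin d) ℝ} (hW : ∀ i j, W i j = W j i)
    (u c : Fin d → ℝ) (t : ℝ) :
    quadForm W (fun i => u i - t * c i) = quadForm W u - 2 * t * ∑ j, (∑ i, c i * W i j) * u j
      + t ^ 2 * ∑ j, (∑ i, c i * W i j) * c j := by
  have h : ∑ j, (∑ i, c i * W i j) * u j = ∑ i, ∑ j, u i * W i j * c j :=
    Finset.sum_congr rfl fun j _ => by
      rw [Finset.sum_mul]
      exact Finset.sum_congr rfl fun i _ => by rw [hW]; ring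
  have h' : ∑ j, (∑ i, c i * W i j) * u j = ∑ i, ∑ j, c i * W i j * u j := by
    simp only [Finset.sum_mul]; exact Finset.sum_comm
  have h'' : ∑ j, (∑ i, c i * W i j) * c j = ∑ i, ∑ j, c i * W i j * c j := by
    simp only [Finset.sum_mul]; exact Finset.sum_comm
  rw [show 2 * t * ∑ j, (∑ i, c i * W i j) * u j = t * ∑ j, (∑ i, c i * W i j) * u j
    + t * ∑ j, (∑ i, c i * W i j) * u j by ring]
  nth_rewrite 1 [h]
  rw [h', h'']
  simp only [quadForm, Finset.mul_sum, ← Finset.sum_add_distrib, ← Finset.sum_sub_distrib]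
  exact Finset.sum_congr rfl fun i _ => Finset.sum_congr rfl fun j _ => by ring

/-- The first row of `Q` below the diagonal, normalized by the corner entry. -/
noncomputable def pivotRow {d : ℕ} (Q : Matrix (Fin (d + 1)) (Fin (d + 1)) ℝ) (i : Fin d) : ℝ :=
  Q 0 i.succ / Q 0 0

/-- The Schur complement of the corner entry of `Q`. -/
noncomputable def schurCompl {d : ℕ} (Q : Matrix (Fin (d + 1)) (Fin (d + 1)) ℝ) :
    Matrix (Fin d) (Fin d) ℝ :=
  fun i j => Q i.succ j.succ - Q 0 0 * pivotRow Q i * pivotRow Q j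

lemma quadForm_eq_schurCompl {d : ℕ} {Q : Matrix (Fin (d + 1)) (Fin (d + 1)) ℝ}
    (hQ : ∀ i j, Q i j = Q j i) (h0 : Q 0 0 ≠ 0) (v : Fin (d + 1) → ℝ) :
    quadForm Q v = Q 0 0 * (v 0 + ∑ i, pivotRow Q i * v i.succ) ^ 2
      + quadForm (schurCompl Q) (fun i => v i.succ) := by
  have h : quadForm (schurCompl Q) (fun i => v i.succ) =
      quadForm (Q.submatrix Fin.succ Fin.succ) (fun i => v i.succ)
        - Q 0 0 * (∑ i, pivotRow Q i * v i.succ) ^ 2 := by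
    rw [sq, Finset.sum_mul_sum]
    simp only [quadForm, schurCompl, Finset.mul_sum, ← Finset.sum_sub_distrib, submatrix_apply]
    exact Finset.sum_congr rfl fun i _ => Finset.sum_congr rfl fun j _ => by ring
  have h' : ∑ j : Fin d, Q 0 j.succ * v j.succ = Q 0 0 * ∑ i, pivotRow Q i * v i.succ := by
    rw [Finset.mul_sum]
    exact Finset.sum_congr rfl fun i _ => by rw [pivotRow]; field_simp
  rw [quadForm_succ hQ, h, h']
  ring

lemma corner_add_sum_pivotRow {d : ℕ} {Q W : Matrix (Fin (d + 1)) (Fin (d + 1)) ℝ}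
    (hQW : Q * W = 1) (h0 : Q 0 0 ≠ 0) (j : Fin (d + 1)) :
    W 0 j + ∑ i, pivotRow Q i * W i.succ j = if j = 0 then 1 / Q 0 0 else 0 := by
  have h := congrFun (congrFun hQW 0) j
  rw [mul_apply, Fin.sum_univ_succ, one_apply] at h
  have h' : ∑ i : Fin d, Q 0 i.succ * W i.succ j = Q 0 0 * ∑ i, pivotRow Q i * W i.succ j := by
    rw [Finset.mul_sum]
    exact Finset.sum_congr rfl fun i _ => by rw [pivotRow]; field_simp
  rw [h', ← mul_add] at h
  rw [eq_div_of_mul_eq h0 ((mul_comm _ _).trans h)]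
  simp only [eq_comm (a := (0 : Fin (d + 1)))]
  split_ifs <;> simp

lemma quadForm_eq_of_mul_eq_one {d : ℕ} {Q W : Matrix (Fin (d + 1)) (Fin (d + 1)) ℝ}
    (hW : ∀ i j, W i j = W j i) (hQW : Q * W = 1) (h0 : Q 0 0 ≠ 0) (v : Fin (d + 1) → ℝ) :
    quadForm W v = v 0 ^ 2 / Q 0 0
      + quadForm (W.submatrix Fin.succ Fin.succ) (fun i => v i.succ - v 0 * pivotRow Q i) := by
  have h1 : ∀ j : Fin d, ∑ i, pivotRow Q i * W i.succ j.succ = -W 0 j.succ := fun j => by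
    have := corner_add_sum_pivotRow hQW h0 j.succ
    simp only [Fin.succ_ne_zero, if_false] at this
    linarith
  have h2 : ∑ j, W 0 (Fin.succ j) * pivotRow Q j = 1 / Q 0 0 - W 0 0 := by
    have := corner_add_sum_pivotRow hQW h0 0
    simp only [if_true] at this
    rw [← this, add_sub_cancel_left]
    exact Finset.sum_congr rfl fun i _ => by rw [hW]; ring
  rw [quadForm_succ hW, quadForm_sub_smul (W := W.submatrix Fin.succ Fin.succ)
    (fun i j => hW _ _)]
  simp only [submatrix_apply, h1, neg_mul, Finset.sum_neg_distrib, h2]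
  ring

lemma schurCompl_mul_submatrix {d : ℕ} {Q W : Matrix (Fin (d + 1)) (Fin (d + 1)) ℝ}
    (hQ : ∀ i j, Q i j = Q j i) (hQW : Q * W = 1) (h0 : Q 0 0 ≠ 0) :
    schurCompl Q * W.submatrix Fin.succ Fin.succ = 1 := by
  ext i j
  have h := congrFun (congrFun hQW i.succ) j.succ
  rw [mul_apply, Fin.sum_univ_succ] at h
  have h1 := corner_add_sum_pivotRow hQW h0 j.succ
  simp only [Fin.succ_ne_zero, if_false] at h1
  have h2 : Q i.succ 0 = Q 0 0 * pivotRow Q i := by rw [hQ, pivotRow]; field_simp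
  have h3 : (schurCompl Q * W.submatrix Fin.succ Fin.succ) i j =
      ∑ k : Fin d, Q i.succ k.succ * W k.succ j.succ
        - Q 0 0 * pivotRow Q i * ∑ k, pivotRow Q k * W k.succ j.succ := by
    simp only [mul_apply, schurCompl, submatrix_apply, Finset.mul_sum, ← Finset.sum_sub_distrib]
    exact Finset.sum_congr rfl fun k _ => by ring
  rw [h2] at h
  rw [h3, eq_neg_of_add_eq_zero_right h1, mul_neg, sub_neg_eq_add, add_comm, h]
  simp [one_apply]

namespace IsCoerciveForm

lemma corner_pos {d : ℕ} {Q : Matrix (Fin (d + 1)) (Fin (d + 1)) ℝ} (hQ : IsCoerciveForm Q) :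
    0 < Q 0 0 := by
  obtain ⟨ε, hε, h⟩ := hQ.bound
  have := h (Pi.single 0 1)
  simp [quadForm, Pi.single_apply] at this
  linarith

lemma schurCompl {d : ℕ} {Q : Matrix (Fin (d + 1)) (Fin (d + 1)) ℝ} (hQ : IsCoerciveForm Q) :
    IsCoerciveForm (schurCompl Q) where
  symm i j := by simp only [_root_.schurCompl, hQ.symm i.succ]; ring
  bound := by
    obtain ⟨ε, hε, h⟩ := hQ.bound
    refine ⟨ε, hε, fun v => ?_⟩
    have := h (Fin.cons (-∑ i, pivotRow Q i * v i) v)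
    rw [quadForm_eq_schurCompl hQ.symm hQ.corner_pos.ne'] at this
    simp only [Fin.sum_univ_succ, Fin.cons_zero, Fin.cons_succ] at this
    nlinarith [mul_nonneg hε.le (sq_nonneg (-∑ i, pivotRow Q i * v i))]

lemma submatrix_succ {d : ℕ} {W : Matrix (Fin (d + 1)) (Fin (d + 1)) ℝ} (hW : IsCoerciveForm W) :
    IsCoerciveForm (W.submatrix Fin.succ Fin.succ) where
  symm i j := hW.symm _ _
  bound := by
    obtain ⟨ε, hε, h⟩ := hW.bound
    refine ⟨ε, hε, fun v => ?_⟩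
    have := h (Fin.cons 0 v)
    rw [quadForm_succ hW.symm] at this
    simpa [Fin.sum_univ_succ] using this

end IsCoerciveForm

lemma summable_prod_apply {d : ℕ} {g : Fin d → ℤ → ℝ} (hg : ∀ i n, 0 ≤ g i n)
    (hs : ∀ i, Summable (g i)) : Summable fun m : Fin d → ℤ => ∏ i, g i (m i) := by
  induction d with
  | zero => exact (hasSum_fintype _).summable
  | succ d ih =>
    rw [← (Fin.consEquiv fun _ => ℤ).summable_iff]
    have := (hs 0).mul_of_nonneg (ih (g := fun i => g i.succ) (fun i => hg _) (fun i => hs _))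
      (hg 0) (fun m => Finset.prod_nonneg fun i _ => hg _ _)
    refine this.congr fun p => ?_
    simp [Fin.consEquiv, Fin.prod_univ_succ]

lemma summable_exp_neg_mul_add_sq {c : ℝ} (hc : 0 < c) (x : ℝ) :
    Summable fun n : ℤ => Real.exp (-c * (n + x) ^ 2) := by
  have := summable_pow_mul_jacobiTheta₂_term_bound (c * |x| / Real.pi)
    (div_pos hc Real.pi_pos) 0
  refine this.of_nonneg_of_le (fun n => (Real.exp_pos _).le) fun n => ?_
  rw [pow_zero, one_mul, Real.exp_le_exp]
  have h1 : -Real.pi * (c / Real.pi * (n : ℝ) ^ 2 - 2 * (c * |x| / Real.pi) * ((|n| : ℤ) : ℝ))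
      = -c * (n : ℝ) ^ 2 + 2 * c * (|x| * |(n : ℝ)|) := by
    have := Real.pi_pos.ne'
    push_cast
    field_simp
    ring
  rw [h1]
  have h2 : -(n * x) ≤ |x| * |(n : ℝ)| := by
    rw [← abs_mul, mul_comm]; exact neg_le_abs _
  nlinarith [mul_le_mul_of_nonneg_left h2 hc.le, mul_nonneg hc.le (sq_nonneg x)]

lemma IsCoerciveForm.summable_exp {d : ℕ} {Q : Matrix (Fin d) (Fin d) ℝ} (hQ : IsCoerciveForm Q)
    {t : ℝ} (ht : 0 < t) (x : Fin d → ℝ) :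
    Summable fun m : Fin d → ℤ => Real.exp (-t * quadForm Q (fun i => m i + x i)) := by
  obtain ⟨ε, hε, h⟩ := hQ.bound
  have := summable_prod_apply (g := fun i n => Real.exp (-(t * ε) * (n + x i) ^ 2))
    (fun _ _ => (Real.exp_pos _).le) (fun i => summable_exp_neg_mul_add_sq (mul_pos ht hε) (x i))
  refine this.of_nonneg_of_le (fun n => (Real.exp_pos _).le) fun m => ?_
  rw [← Real.exp_sum, Real.exp_le_exp, ← Finset.mul_sum]
  nlinarith [mul_le_mul_of_nonneg_left (h fun i => m i + x i) ht.le]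

/-- The general term of the theta series of `Q` with characteristics `x`, `y`. -/
noncomputable def thetaTerm {d : ℕ} (Q : Matrix (Fin d) (Fin d) ℝ) (z : ℂ) (x y : Fin d → ℝ)
    (m : Fin d → ℤ) : ℂ :=
  Complex.exp (Real.pi * Complex.I * (quadForm Q (fun i => m i + x i) : ℝ) * z
    + 2 * Real.pi * Complex.I * (∑ i, m i * y i : ℝ))

lemma norm_thetaTerm {d : ℕ} (Q : Matrix (Fin d) (Fin d) ℝ) (z : ℂ) (x y : Fin d → ℝ)
    (m : Fin d → ℤ) :
    ‖thetaTerm Q z x y m‖ = Real.exp (-(Real.pi * z.im) * quadForm Q (fun i => m i + x i)) := by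
  rw [thetaTerm, Complex.norm_exp]
  congr 1
  simp [-Complex.ofReal_sum]
  ring

lemma IsCoerciveForm.summable_thetaTerm {d : ℕ} {Q : Matrix (Fin d) (Fin d) ℝ}
    (hQ : IsCoerciveForm Q) {z : ℂ} (hz : 0 < z.im) (x y : Fin d → ℝ) :
    Summable (thetaTerm Q z x y) := by
  refine Summable.of_norm ((hQ.summable_exp (mul_pos Real.pi_pos hz) x).congr fun m => ?_)
  rw [norm_thetaTerm]

lemma neg_inv_im_pos {z : ℂ} (hz : 0 < z.im) : 0 < (-z⁻¹).im := by
  rw [Complex.neg_im, Complex.inv_im, neg_div, neg_neg]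
  exact div_pos hz (Complex.normSq_pos.2 fun h => by simp [h] at hz)

lemma ofReal_mul_cpow {a : ℝ} (ha : 0 < a) {w : ℂ} (hw : w ≠ 0) (s : ℂ) :
    ((a : ℂ) * w) ^ s = (a : ℂ) ^ s * w ^ s := by
  have ha0 : (a : ℂ) ≠ 0 := Complex.ofReal_ne_zero.2 ha.ne'
  rw [Complex.cpow_def_of_ne_zero (mul_ne_zero ha0 hw), Complex.cpow_def_of_ne_zero ha0,
    Complex.cpow_def_of_ne_zero hw, Complex.log_ofReal_mul ha hw, add_mul, Complex.exp_add,
    Complex.ofReal_log ha.le]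

lemma tsum_exp_sq_transform {a : ℝ} (ha : 0 < a) {z : ℂ} (hz : 0 < z.im) (x y : ℝ) :
    ∑' n : ℤ, Complex.exp (Real.pi * Complex.I * (a * (n + x) ^ 2 : ℝ) * z
        + 2 * Real.pi * Complex.I * (n * y : ℝ))
      = 1 / (a : ℂ) ^ (1 / 2 : ℂ) * (1 / (-Complex.I * z) ^ (1 / 2 : ℂ)) *
        ∑' n : ℤ, Complex.exp (Real.pi * Complex.I * ((n + y) ^ 2 / a : ℝ) * (-z⁻¹)
          - 2 * Real.pi * Complex.I * ((n + y) * x : ℝ)) := by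
  have hz0 : z ≠ 0 := fun h => by simp [h] at hz
  have ha0 : (a : ℂ) ≠ 0 := Complex.ofReal_ne_zero.2 ha.ne'
  have hre : 0 < ((a : ℂ) * (-Complex.I * z)).re := by simp [ha, hz]
  have key := Complex.tsum_exp_neg_quadratic hre (-(a * (-Complex.I * z)) * x + Complex.I * y)
  rw [ofReal_mul_cpow ha (mul_ne_zero (neg_ne_zero.2 Complex.I_ne_zero) hz0)] at key
  have h1 : ∀ n : ℤ, Complex.exp (Real.pi * Complex.I * (a * (n + x) ^ 2 : ℝ) * z
        + 2 * Real.pi * Complex.I * (n * y : ℝ)) =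
      Complex.exp (-Real.pi * (a * (-Complex.I * z)) * x ^ 2) *
      Complex.exp (-Real.pi * (a * (-Complex.I * z)) * n ^ 2
        + 2 * Real.pi * (-(a * (-Complex.I * z)) * x + Complex.I * y) * n) := fun n => by
    rw [← Complex.exp_add]
    congr 1
    push_cast
    ring
  have h2 : ∀ n : ℤ, Complex.exp (Real.pi * Complex.I * ((n + y) ^ 2 / a : ℝ) * (-z⁻¹)
          - 2 * Real.pi * Complex.I * ((n + y) * x : ℝ)) =
      Complex.exp (-Real.pi * (a * (-Complex.I * z)) * x ^ 2) *
      Complex.exp (-Real.pi / (a * (-Complex.I * z)) *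
        (((-n : ℤ) : ℂ) + Complex.I * (-(a * (-Complex.I * z)) * x + Complex.I * y)) ^ 2) :=
    fun n => by
    rw [← Complex.exp_add]
    congr 1
    have hI := Complex.I_ne_zero
    push_cast
    field_simp
    ring_nf
    simp only [Complex.I_sq, Complex.I_pow_four]
    ring_nf
  rw [tsum_congr h1, tsum_congr h2, tsum_mul_left, tsum_mul_left, key,
    ← (Equiv.neg ℤ).tsum_eq fun n : ℤ => Complex.exp (-Real.pi / (a * (-Complex.I * z)) *
        ((n : ℂ) + Complex.I * (-(a * (-Complex.I * z)) * x + Complex.I * y)) ^ 2)]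
  simp only [Equiv.neg_apply]
  ring

lemma tsum_fin_succ {d : ℕ} {f : (Fin (d + 1) → ℤ) → ℂ} (hf : Summable f) :
    ∑' m, f m = ∑' (n : ℤ) (k : Fin d → ℤ), f (Fin.cons n k) := by
  rw [← (Fin.consEquiv fun _ => ℤ).tsum_eq f]
  exact ((Fin.consEquiv fun _ => ℤ).summable_iff.2 hf).tsum_prod

lemma tsum_fin_succ' {d : ℕ} {f : (Fin (d + 1) → ℤ) → ℂ} (hf : Summable f) :
    ∑' m, f m = ∑' (k : Fin d → ℤ) (n : ℤ), f (Fin.cons n k) := by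
  rw [tsum_fin_succ hf]
  exact (Summable.tsum_comm (f := fun n k => f (Fin.cons n k))
    ((Fin.consEquiv fun _ => ℤ).summable_iff.2 hf)).symm

lemma thetaTerm_cons {d : ℕ} {Q : Matrix (Fin (d + 1)) (Fin (d + 1)) ℝ} (hQ : IsCoerciveForm Q)
    (z : ℂ) (x y : Fin (d + 1) → ℝ) (n : ℤ) (k : Fin d → ℤ) :
    thetaTerm Q z x y (Fin.cons n k) =
      Complex.exp (Real.pi * Complex.I *
          (Q 0 0 * (n + (x 0 + ∑ i, pivotRow Q i * (k i + x i.succ))) ^ 2 : ℝ) * z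
        + 2 * Real.pi * Complex.I * (n * y 0 : ℝ)) *
      thetaTerm (schurCompl Q) z (fun i => x i.succ) (fun i => y i.succ) k := by
  rw [thetaTerm, thetaTerm, ← Complex.exp_add, quadForm_eq_schurCompl hQ.symm hQ.corner_pos.ne']
  congr 1
  simp only [Fin.sum_univ_succ, Fin.cons_zero, Fin.cons_succ]
  push_cast
  ring

/-- The factor depending only on the first dual variable `n` in the iterated Poisson summation. -/
noncomputable def pivotTerm {d : ℕ} (Q : Matrix (Fin (d + 1)) (Fin (d + 1)) ℝ) (z : ℂ)
    (x y : Fin (d + 1) → ℝ) (n : ℤ) : ℂ :=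
  Complex.exp (Real.pi * Complex.I * ((n + y 0) ^ 2 / Q 0 0 : ℝ) * (-z⁻¹)
    - 2 * Real.pi * Complex.I * ((n + y 0) * (x 0 + ∑ i, pivotRow Q i * x i.succ) : ℝ))

lemma summable_norm_pivotTerm {d : ℕ} {Q : Matrix (Fin (d + 1)) (Fin (d + 1)) ℝ}
    (hQ : IsCoerciveForm Q) {z : ℂ} (hz : 0 < z.im) (x y : Fin (d + 1) → ℝ) :
    Summable fun n => ‖pivotTerm Q z x y n‖ := by
  have := summable_exp_neg_mul_add_sq
    (div_pos (mul_pos Real.pi_pos (neg_inv_im_pos hz)) hQ.corner_pos) (y 0)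
  refine this.congr fun n => ?_
  rw [pivotTerm, Complex.norm_exp]
  congr 1
  generalize -z⁻¹ = w
  simp [-Complex.ofReal_sum, -Complex.ofReal_mul, -Complex.ofReal_div, -Complex.ofReal_pow,
    -Complex.ofReal_add]
  ring

lemma exp_mul_thetaTerm_schurCompl {d : ℕ} (Q : Matrix (Fin (d + 1)) (Fin (d + 1)) ℝ)
    (z : ℂ) (x y : Fin (d + 1) → ℝ) (n : ℤ) (k : Fin d → ℤ) :
    Complex.exp (Real.pi * Complex.I * ((n + y 0) ^ 2 / Q 0 0 : ℝ) * (-z⁻¹)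
        - 2 * Real.pi * Complex.I *
          ((n + y 0) * (x 0 + ∑ i, pivotRow Q i * (k i + x i.succ)) : ℝ)) *
      thetaTerm (schurCompl Q) z (fun i => x i.succ) (fun i => y i.succ) k =
    pivotTerm Q z x y n * thetaTerm (schurCompl Q) z (fun i => x i.succ)
      (fun i => y i.succ - (n + y 0) * pivotRow Q i) k := by
  rw [thetaTerm, thetaTerm, pivotTerm, ← Complex.exp_add, ← Complex.exp_add]
  congr 1
  have h1 : ∑ i, pivotRow Q i * (k i + x i.succ) =
      ∑ i, pivotRow Q i * k i + ∑ i, pivotRow Q i * x i.succ := by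
    simp only [mul_add, Finset.sum_add_distrib]
  have h2 : ∑ i, (k i : ℝ) * (y i.succ - (n + y 0) * pivotRow Q i) =
      ∑ i, (k i : ℝ) * y i.succ - (n + y 0) * ∑ i, pivotRow Q i * k i := by
    rw [Finset.mul_sum, ← Finset.sum_sub_distrib]
    exact Finset.sum_congr rfl fun i _ => by ring
  rw [h1, h2]
  push_cast
  ring

lemma pivotTerm_mul_thetaTerm {d : ℕ} {Q W : Matrix (Fin (d + 1)) (Fin (d + 1)) ℝ}
    (hQ : IsCoerciveForm Q) (hW : IsCoerciveForm W) (hQW : Q * W = 1)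
    (z : ℂ) (x y : Fin (d + 1) → ℝ) (n : ℤ) (k : Fin d → ℤ) :
    pivotTerm Q z x y n *
      (Complex.exp (-(2 * Real.pi * Complex.I *
        (∑ i : Fin d, x i.succ * (y i.succ - (n + y 0) * pivotRow Q i) : ℝ))) *
      thetaTerm (W.submatrix Fin.succ Fin.succ) (-z⁻¹)
        (fun i => y i.succ - (n + y 0) * pivotRow Q i) (fun i => -x i.succ) k) =
    Complex.exp (-(2 * Real.pi * Complex.I * (∑ i, x i * y i : ℝ))) *
      thetaTerm W (-z⁻¹) y (fun i => -x i) (Fin.cons n k) := by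
  rw [thetaTerm, thetaTerm, pivotTerm, ← Complex.exp_add, ← Complex.exp_add, ← Complex.exp_add,
    quadForm_eq_of_mul_eq_one hW.symm hQW hQ.corner_pos.ne']
  congr 1
  have h1 : ∑ i : Fin d, x i.succ * (y i.succ - (n + y 0) * pivotRow Q i) =
      ∑ i : Fin d, x i.succ * y i.succ - (n + y 0) * ∑ i, pivotRow Q i * x i.succ := by
    rw [Finset.mul_sum, ← Finset.sum_sub_distrib]
    exact Finset.sum_congr rfl fun i _ => by ring
  simp only [h1, Fin.sum_univ_succ, Fin.cons_zero, Fin.cons_succ, add_sub_assoc]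
  push_cast
  ring

/-- Transformation law of theta series with characteristics under `z ↦ -z⁻¹`, with an unspecified
constant (in fact `(det Q)^(-1/2)`) independent of `z` and of the characteristics. -/
theorem exists_tsum_thetaTerm_transform {d : ℕ} {Q W : Matrix (Fin d) (Fin d) ℝ}
    (hQ : IsCoerciveForm Q) (hW : IsCoerciveForm W) (hQW : Q * W = 1) :
    ∃ C : ℂ, ∀ z : ℂ, 0 < z.im → ∀ x y : Fin d → ℝ,
      ∑' m, thetaTerm Q z x y m = C * (1 / (-Complex.I * z) ^ (1 / 2 : ℂ)) ^ d *
        (Complex.exp (-(2 * Real.pi * Complex.I * (∑ i, x i * y i : ℝ))) *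
          ∑' m, thetaTerm W (-z⁻¹) y (fun i => -x i) m) := by
  induction d with
  | zero => exact ⟨1, fun z hz x y => by simp [thetaTerm, quadForm]⟩
  | succ d ih =>
    obtain ⟨C, hC⟩ := ih hQ.schurCompl hW.submatrix_succ
      (schurCompl_mul_submatrix hQ.symm hQW hQ.corner_pos.ne')
    refine ⟨1 / (Q 0 0 : ℂ) ^ (1 / 2 : ℂ) * C, fun z hz x y => ?_⟩
    set s : ℂ := 1 / (-Complex.I * z) ^ (1 / 2 : ℂ) with hs
    have hsum : Summable (Function.uncurry fun (n : ℤ) (k : Fin d → ℤ) =>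
        pivotTerm Q z x y n * thetaTerm (schurCompl Q) z (fun i => x i.succ)
          (fun i => y i.succ - (n + y 0) * pivotRow Q i) k) := by
      refine Summable.of_norm (((summable_norm_pivotTerm hQ hz x y).mul_of_nonneg
        (hQ.schurCompl.summable_exp (mul_pos Real.pi_pos hz) fun i => x i.succ)
        (fun _ => norm_nonneg _) (fun _ => (Real.exp_pos _).le)).congr fun p => ?_)
      rw [Function.uncurry, norm_mul, norm_thetaTerm]
    have hinner : ∀ k : Fin d → ℤ, ∑' n : ℤ, thetaTerm Q z x y (Fin.cons n k) =
        1 / (Q 0 0 : ℂ) ^ (1 / 2 : ℂ) * s * ∑' n : ℤ, pivotTerm Q z x y n *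
          thetaTerm (schurCompl Q) z (fun i => x i.succ)
            (fun i => y i.succ - (n + y 0) * pivotRow Q i) k := fun k => by
      simp only [thetaTerm_cons hQ, tsum_mul_right, tsum_exp_sq_transform hQ.corner_pos hz]
      rw [mul_assoc, ← tsum_mul_right]
      simp only [exp_mul_thetaTerm_schurCompl, hs]
    rw [tsum_fin_succ' (hQ.summable_thetaTerm hz x y),
      tsum_fin_succ (hW.summable_thetaTerm (neg_inv_im_pos hz) y fun i => -x i),
      tsum_congr hinner, tsum_mul_left, hsum.tsum_comm]
    simp only [tsum_mul_left, hC z hz, ← hs]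
    simp only [← tsum_mul_left, ← pivotTerm_mul_thetaTerm hQ hW hQW]
    exact tsum_congr fun n => tsum_congr fun k => by ring

lemma quadForm_transpose_mul_self {d : ℕ} (M : Matrix (Fin d) (Fin d) ℝ) (v : Fin d → ℝ) :
    quadForm (Mᵀ * M) v = ∑ j, (M *ᵥ v) j ^ 2 := by
  have h : quadForm (Mᵀ * M) v = v ⬝ᵥ (Mᵀ * M) *ᵥ v := by
    simp only [quadForm, dotProduct, mulVec, Finset.mul_sum, mul_assoc]
  rw [h, ← mulVec_mulVec, dotProduct_transpose_mulVec]
  simp only [dotProduct, sq]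

lemma isCoerciveForm_transpose_mul_self {d : ℕ} {M : Matrix (Fin d) (Fin d) ℝ}
    (hM : IsUnit M.det) : IsCoerciveForm (Mᵀ * M) where
  symm i j := by simp only [mul_apply, transpose_apply, mul_comm]
  bound := by
    set K : ℝ := ∑ i, ∑ j, M⁻¹ i j ^ 2
    have hK : 0 ≤ K := Finset.sum_nonneg fun i _ => Finset.sum_nonneg fun j _ => sq_nonneg _
    refine ⟨1 / (K + 1), by positivity, fun v => ?_⟩
    rw [quadForm_transpose_mul_self, one_div_mul_eq_div, div_le_iff₀ (by positivity)]
    have hS : 0 ≤ ∑ j, (M *ᵥ v) j ^ 2 := Finset.sum_nonneg fun j _ => sq_nonneg _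
    have hv : M⁻¹ *ᵥ (M *ᵥ v) = v := by rw [mulVec_mulVec, nonsing_inv_mul _ hM, one_mulVec]
    have h : ∑ i, v i ^ 2 ≤ K * ∑ j, (M *ᵥ v) j ^ 2 := by
      rw [Finset.sum_mul]
      refine Finset.sum_le_sum fun i _ => ?_
      nth_rewrite 1 [← hv]
      exact Finset.sum_mul_sq_le_sq_mul_sq Finset.univ (M⁻¹ i) (M *ᵥ v)
    linarith

lemma mulVec_intCast_injective {d : ℕ} {M : Matrix (Fin d) (Fin d) ℝ} (hM : IsUnit M.det) :
    Function.Injective fun m : Fin d → ℤ => M *ᵥ fun i => (m i : ℝ) := fun m n h => by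
  have := mulVec_injective_of_isUnit ((isUnit_iff_isUnit_det M).2 hM) h
  exact funext fun i => by exact_mod_cast congrFun this i

/-- A sum over a lattice can be parametrized by any of its bases. -/
lemma tsum_comp_mulVec_eq_of_range_eq {d : ℕ} {M N : Matrix (Fin d) (Fin d) ℝ}
    (hM : IsUnit M.det) (hN : IsUnit N.det)
    (h : (Set.range fun m : Fin d → ℤ => M *ᵥ fun i => (m i : ℝ))
      = Set.range fun k : Fin d → ℤ => N *ᵥ fun i => (k i : ℝ)) (F : (Fin d → ℝ) → ℂ) :
    ∑' m : Fin d → ℤ, F (M *ᵥ fun i => (m i : ℝ)) =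
      ∑' k : Fin d → ℤ, F (N *ᵥ fun i => (k i : ℝ)) := by
  rw [← tsum_range F (mulVec_intCast_injective hM), ← tsum_range F (mulVec_intCast_injective hN),
    h]

/-- The general term, as a function of the lattice vector `v`, of the theta series of a lattice
shifted by `p` and twisted by the character of `q`. -/
noncomputable def latticeTerm {d : ℕ} (z : ℂ) (p q v : Fin d → ℝ) : ℂ :=
  Complex.exp (Real.pi * Complex.I * (∑ j, (v j + p j) ^ 2 : ℝ) * z
    + 2 * Real.pi * Complex.I * (∑ j, v j * q j : ℝ))

lemma thetaTerm_transpose_mul_self {d : ℕ} (M : Matrix (Fin d) (Fin d) ℝ) (z : ℂ)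
    (x q : Fin d → ℝ) (m : Fin d → ℤ) :
    thetaTerm (Mᵀ * M) z x (Mᵀ *ᵥ q) m =
      latticeTerm z (M *ᵥ x) q (M *ᵥ fun i => (m i : ℝ)) := by
  have h : (fun i => (m i : ℝ) + x i) = (fun i => (m i : ℝ)) + x := rfl
  have h' : ∑ i, (m i : ℝ) * (Mᵀ *ᵥ q) i = ∑ j, (M *ᵥ fun i => (m i : ℝ)) j * q j := by
    change (fun i => (m i : ℝ)) ⬝ᵥ Mᵀ *ᵥ q = (M *ᵥ fun i => (m i : ℝ)) ⬝ᵥ q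
    rw [dotProduct_transpose_mulVec, dotProduct_comm]
  rw [thetaTerm, latticeTerm, quadForm_transpose_mul_self, h, h', mulVec_add]
  rfl

/-- Transformation law for the theta series of a self-dual lattice with characteristics. -/
theorem tsum_latticeTerm_transform {d : ℕ} {A : Matrix (Fin d) (Fin d) ℝ} (hA : IsUnit A.det)
    (hself : (Set.range fun m : Fin d → ℤ => A *ᵥ fun i => (m i : ℝ))
      = Set.range fun k : Fin d → ℤ => (Aᵀ)⁻¹ *ᵥ fun i => (k i : ℝ))
    {z : ℂ} (hz : 0 < z.im) (p q : Fin d → ℝ) :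
    ∑' m : Fin d → ℤ, latticeTerm z p q (A *ᵥ fun i => (m i : ℝ)) =
      (1 / (-Complex.I * z) ^ (1 / 2 : ℂ)) ^ d *
        (Complex.exp (-(2 * Real.pi * Complex.I * (∑ j, p j * q j : ℝ))) *
          ∑' m : Fin d → ℤ, latticeTerm (-z⁻¹) q (-p) (A *ᵥ fun i => (m i : ℝ))) := by
  have hAt : IsUnit Aᵀ.det := by rwa [det_transpose]
  have hB : IsUnit ((Aᵀ)⁻¹).det := isUnit_nonsing_inv_det _ hAt
  have hBt : ((Aᵀ)⁻¹)ᵀ = A⁻¹ := by rw [transpose_nonsing_inv, transpose_transpose]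
  have hQW : (Aᵀ * A) * (((Aᵀ)⁻¹)ᵀ * (Aᵀ)⁻¹) = 1 := by
    rw [hBt, Matrix.mul_assoc, ← Matrix.mul_assoc A, mul_nonsing_inv _ hA, Matrix.one_mul,
      mul_nonsing_inv _ hAt]
  obtain ⟨C, hC⟩ := exists_tsum_thetaTerm_transform (isCoerciveForm_transpose_mul_self hA)
    (isCoerciveForm_transpose_mul_self hB) hQW
  have key : ∀ w : ℂ, 0 < w.im → ∀ p q : Fin d → ℝ,
      ∑' m : Fin d → ℤ, latticeTerm w p q (A *ᵥ fun i => (m i : ℝ)) =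
      C * (1 / (-Complex.I * w) ^ (1 / 2 : ℂ)) ^ d *
        (Complex.exp (-(2 * Real.pi * Complex.I * (∑ j, p j * q j : ℝ))) *
          ∑' m : Fin d → ℤ, latticeTerm (-w⁻¹) q (-p) (A *ᵥ fun i => (m i : ℝ))) := by
    intro w hw p q
    have hp : A *ᵥ (A⁻¹ *ᵥ p) = p := by rw [mulVec_mulVec, mul_nonsing_inv _ hA, one_mulVec]
    have hq : (Aᵀ)⁻¹ *ᵥ (Aᵀ *ᵥ q) = q := by
      rw [mulVec_mulVec, nonsing_inv_mul _ hAt, one_mulVec]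
    have hp' : (fun i => -(A⁻¹ *ᵥ p) i) = ((Aᵀ)⁻¹)ᵀ *ᵥ (-p) := by
      rw [hBt, mulVec_neg]; rfl
    have hpq : ∑ i, (A⁻¹ *ᵥ p) i * (Aᵀ *ᵥ q) i = ∑ j, p j * q j := by
      change (A⁻¹ *ᵥ p) ⬝ᵥ Aᵀ *ᵥ q = p ⬝ᵥ q
      rw [dotProduct_transpose_mulVec, hp, dotProduct_comm]
    have h := hC w hw (A⁻¹ *ᵥ p) (Aᵀ *ᵥ q)
    simp only [hp', thetaTerm_transpose_mul_self, hp, hq, hpq] at h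
    rw [h, tsum_comp_mulVec_eq_of_range_eq hA hB hself]
  suffices hC1 : C = 1 by rw [key z hz, hC1, one_mul]
  have hI := key Complex.I (by simp) 0 0
  have hne : ∑' m : Fin d → ℤ, latticeTerm Complex.I 0 0 (A *ᵥ fun i => (m i : ℝ)) ≠ 0 := by
    have hterm : ∀ m : Fin d → ℤ, latticeTerm Complex.I 0 0 (A *ᵥ fun i => (m i : ℝ)) =
        (Real.exp (-Real.pi * quadForm (Aᵀ * A) (fun i => m i + 0)) : ℝ) := fun m => by
      rw [latticeTerm, Complex.ofReal_exp]
      congr 1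
      simp only [quadForm_transpose_mul_self, add_zero, Pi.zero_apply, mul_zero,
        Finset.sum_const_zero, Complex.ofReal_zero, Complex.ofReal_mul, Complex.ofReal_neg]
      linear_combination (Real.pi : ℂ) * (∑ j, (A *ᵥ fun i => (m i : ℝ)) j ^ 2 : ℝ) * Complex.I_sq
    rw [tsum_congr hterm, ← Complex.ofReal_tsum, Complex.ofReal_ne_zero]
    exact (((isCoerciveForm_transpose_mul_self hA).summable_exp Real.pi_pos fun _ => 0).tsum_pos
      (fun _ => (Real.exp_pos _).le) 0 (Real.exp_pos _)).ne'
  simp only [Complex.inv_I, neg_neg, neg_zero, neg_mul, Complex.I_mul_I, Complex.one_cpow, div_one,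
    one_pow, mul_one, Pi.zero_apply, mul_zero, Finset.sum_const_zero, Complex.ofReal_zero,
    Complex.exp_zero, one_mul] at hI
  exact (mul_eq_right₀ hne).1 hI.symm



/-- **Transformation law of the generalized modular discriminant** (slice form of
the computation following Definition 4.21): for a self-dual lattice `L = A·ℤ^d` and `q̃ = (1/2)·A·m₀`, the function
`Δ_q̃ = (θ·θ̃_q̃·θ̃̃_q̃)^8` satisfies `Δ_q̃(z) = (−iz)^{−12d} Δ_q̃(−z⁻¹)` for `Im z > 0`. -/
theorem discriminant_transformation (d : ℕ) (hd : 1 ≤ d)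
    (A : Matrix (Fin d) (Fin d) ℝ) (hA : IsUnit A.det)
    (hself : (Set.range fun m : Fin d → ℤ => A.mulVec fun i => (m i : ℝ))
      = Set.range fun k : Fin d → ℤ => (Aᵀ)⁻¹.mulVec fun i => (k i : ℝ))
    (m₀ : Fin d → ℤ) (qt : Fin d → ℝ)
    (hqt : qt = (1 / 2 : ℝ) • A.mulVec fun i => (m₀ i : ℝ))
    (θ θ₁ θ₂ Δ : ℂ → ℂ)
    (hθ : ∀ z : ℂ, 0 < z.im → θ z = ∑' m : Fin d → ℤ,
      Complex.exp ((Real.pi : ℂ) * Complex.I *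
        ((∑ j, (A.mulVec (fun i => (m i : ℝ)) j) ^ 2 : ℝ) : ℂ) * z))
    (hθ₁ : ∀ z : ℂ, 0 < z.im → θ₁ z = ∑' m : Fin d → ℤ,
      Complex.exp ((Real.pi : ℂ) * Complex.I *
          ((∑ j, (A.mulVec (fun i => (m i : ℝ)) j) ^ 2 : ℝ) : ℂ) * z
        + 2 * (Real.pi : ℂ) * Complex.I *
          ((∑ j, A.mulVec (fun i => (m i : ℝ)) j * qt j : ℝ) : ℂ)))
    (hθ₂ : ∀ z : ℂ, 0 < z.im → θ₂ z = ∑' m : Fin d → ℤ,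
      Complex.exp ((Real.pi : ℂ) * Complex.I *
        ((∑ j, (A.mulVec (fun i => (m i : ℝ)) j + qt j) ^ 2 : ℝ) : ℂ) * z))
    (hΔ : ∀ z : ℂ, 0 < z.im → Δ z = (θ z * θ₁ z * θ₂ z) ^ 8)
    (z : ℂ) (hz : 0 < z.im) :
    Δ z = (-Complex.I * z) ^ (-(12 * d : ℂ)) * Δ (-z⁻¹) := by
  have hw := neg_inv_im_pos hz
  set s : ℂ := 1 / (-Complex.I * z) ^ (1 / 2 : ℂ) with hs
  have e : ∀ w : ℂ, 0 < w.im →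
      θ w = ∑' m : Fin d → ℤ, latticeTerm w 0 0 (A *ᵥ fun i => (m i : ℝ)) := fun w h => by
    simp [hθ w h, latticeTerm]
  have e₁ : ∀ w : ℂ, 0 < w.im →
      θ₁ w = ∑' m : Fin d → ℤ, latticeTerm w 0 qt (A *ᵥ fun i => (m i : ℝ)) := fun w h => by
    simp [hθ₁ w h, latticeTerm]
  have e₂ : ∀ w : ℂ, 0 < w.im →
      θ₂ w = ∑' m : Fin d → ℤ, latticeTerm w qt 0 (A *ᵥ fun i => (m i : ℝ)) := fun w h => by
    simp [hθ₂ w h, latticeTerm]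
  have hneg : ∑' m : Fin d → ℤ, latticeTerm (-z⁻¹) 0 (-qt) (A *ᵥ fun i => (m i : ℝ)) =
      ∑' m : Fin d → ℤ, latticeTerm (-z⁻¹) 0 qt (A *ᵥ fun i => (m i : ℝ)) := by
    rw [← (Equiv.neg (Fin d → ℤ)).tsum_eq]
    refine tsum_congr fun m => ?_
    have h : (fun i => (((Equiv.neg (Fin d → ℤ)) m i : ℤ) : ℝ)) = -fun i => (m i : ℝ) := by
      ext i; simp
    rw [h, mulVec_neg]
    simp [latticeTerm]
  have t : θ z = s ^ d * θ (-z⁻¹) := by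
    rw [e z hz, e _ hw, tsum_latticeTerm_transform hA hself hz]
    simp [hs]
  have t₁ : θ₁ z = s ^ d * θ₂ (-z⁻¹) := by
    rw [e₁ z hz, e₂ _ hw, tsum_latticeTerm_transform hA hself hz]
    simp [hs]
  have t₂ : θ₂ z = s ^ d * θ₁ (-z⁻¹) := by
    rw [e₂ z hz, e₁ _ hw, tsum_latticeTerm_transform hA hself hz, hneg]
    simp [hs]
  have hpow : (-Complex.I * z) ^ (-(12 * d : ℂ)) = s ^ (24 * d) := by
    rw [hs, one_div, inv_pow, ← Complex.cpow_nat_mul, Complex.cpow_neg]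
    push_cast
    ring_nf
  rw [hΔ z hz, hΔ _ hw, t, t₁, t₂, hpow]
  ring
end
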